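/- arXiv:1103.1437 — 3 statements merged into one kernel-verified Lean document; each statement's English description precedes it below -/
import Mathlib

section
/- If N is an odd perfect number and q^α exactly divides N with q prime, then σ(N/q^α)/q^α > 5. -/
/-- geometric sum `1 + x + ... + x^(n-1)` -/
def G (x n : ℕ) : ℕ := ∑ i ∈ Finset.range n, x ^ i

lemma G_zero (x : ℕ) : G x 0 = 0 := by simp [G]
lemma G_one (x : ℕ) : G x 1 = 1 := by simp [G]
lemma G_succ (x n : ℕ) : G x (n+1) = G x n + x ^ n := by simp [G, Finset.sum_range_succ]
lemma G_succ' (x n : ℕ) : G x (n+1) = x * G x n + 1 := by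
  induction n with
  | zero => simp [G]
  | succ k ih => have h := G_succ x k; rw [G_succ x (k+1)]; rw [h] at ih ⊢; rw [pow_succ]; linarith
lemma G_add (x m n : ℕ) : G x (m+n) = G x m + x ^ m * G x n := by
  induction n with
  | zero => simp [G_zero]
  | succ k ih => rw [← add_assoc, G_succ, ih, G_succ]; ring
lemma G_mul (x n t : ℕ) : G x (n*t) = G x n * G (x^n) t := by
  induction t with
  | zero => simp [G_zero]
  | succ k ih => rw [Nat.mul_succ, G_add, ih, G_succ]; ring
lemma G_eq (x n : ℕ) : x * G (x+1) n + 1 = (x+1)^n := by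
  induction n with
  | zero => simp [G_zero]
  | succ k ih => rw [G_succ, pow_succ, mul_add]; linarith
lemma G_dvd (x n : ℕ) (hx : 1 ≤ x) : G x n ∣ x^n - 1 := by
  obtain ⟨y, rfl⟩ := Nat.exists_eq_add_of_le' hx
  rw [← G_eq]; simp
lemma G_modEq (x n d : ℕ) (h : x ≡ 1 [MOD d]) : G x n ≡ n [MOD d] := by
  induction n with
  | zero => simp [G_zero]; rfl
  | succ k ih => rw [G_succ]; simpa using ih.add (h.pow k)
lemma le_G (x n : ℕ) (hx : 1 ≤ x) : n ≤ G x n := by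
  induction n with
  | zero => simp
  | succ k ih => rw [G_succ]; have := Nat.one_le_pow k x hx; omega
lemma G_gt (x n : ℕ) (hx : 2 ≤ x) (hn : 2 ≤ n) : n < G x n := by
  obtain ⟨k, rfl⟩ := Nat.exists_eq_add_of_le' hn
  rw [G_succ]
  have := le_G x (k+1) (by omega)
  have : 1 < x^(k+1) := Nat.one_lt_pow (by omega) (by omega)
  omega
lemma sigma_pow (p a : ℕ) (hp : p.Prime) : ArithmeticFunction.sigma 1 (p^a) = G p (a+1) :=
  ArithmeticFunction.sigma_one_apply_prime_pow hp
lemma sigma_split (p a n : ℕ) (hp : p.Prime) (hn : ¬ p ∣ n) :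
    ArithmeticFunction.sigma 1 (p^a*n) = G p (a+1) * ArithmeticFunction.sigma 1 n := by
  rw [← sigma_pow p a hp]
  exact ArithmeticFunction.isMultiplicative_sigma.map_mul_of_coprime
    (Nat.Coprime.pow_left _ ((Nat.Prime.coprime_iff_not_dvd hp).2 hn))
lemma G_coprime (p n : ℕ) : Nat.Coprime (G p (n+1)) p := by
  rw [G_succ']; simp
lemma odd_mod (x : ℕ) (h : Odd x) : x ≡ 1 [MOD 2] := Nat.odd_iff.1 h
lemma G_parity (x n : ℕ) (h : Odd x) : G x n % 2 = n % 2 := G_modEq x n 2 (odd_mod x h)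

/-- a nontrivial repunit in base A, with q ∣ A - 1, is not a power of q -/
lemma repunit_pow (A q t c : ℕ) (hA : 2 ≤ A) (hq : q.Prime) (hqo : Odd q) (hqA : q ∣ A - 1)
    (ht : t ≠ 0) (h : G A t = q ^ c) : t = 1 := by
  by_contra hne
  have hF : Fact q.Prime := ⟨hq⟩
  have hnd : ¬ q ∣ A := by
    intro hd
    have : q ∣ A - (A - 1) := Nat.dvd_sub hd hqA
    rw [show A - (A-1) = 1 by omega] at this
    exact hq.one_lt.ne' (Nat.dvd_one.1 this)
  have h1 := padicValNat.pow_sub_pow (p := q) (x := A) (y := 1) hqo (by omega) hqA hnd ht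
  have h2 : A^t - 1 = (A-1) * q^c := by
    rw [← h]
    obtain ⟨y, rfl⟩ := Nat.exists_eq_add_of_le' (show 1 ≤ A by omega)
    rw [← G_eq]; simp
  rw [one_pow, h2, padicValNat.mul (by omega) (pow_ne_zero _ hq.ne_zero), padicValNat.prime_pow] at h1
  have h3 : q ^ c ∣ t := (padicValNat_dvd_iff_le ht).2 (by omega)
  have := Nat.le_of_dvd (by omega) h3
  have := G_gt A t hA (by omega)
  omega

/-- if σ(p^a) = q^b and p^e ∣ q^D - 1 then p^(e-1) ∣ D -/
lemma lift_exp (p q a b e D : ℕ) (hp : p.Prime) (hpo : Odd p) (hq : 2 ≤ q) (ha : 1 ≤ a) (hD : D ≠ 0)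
    (h : G p (a+1) = q^b) (hd : p^e ∣ q^D - 1) : p^(e-1) ∣ D := by
  have hF : Fact p.Prime := ⟨hp⟩
  obtain ⟨a, rfl⟩ := Nat.exists_eq_add_of_le' ha
  have h1 : q^b - 1 = p * G p (a+1) := by rw [← h, G_succ']; simp
  have hG : ¬ p ∣ G p (a+1) := by
    rw [← Nat.Prime.coprime_iff_not_dvd hp]; exact (G_coprime p a).symm
  have hG0 : G p (a+1) ≠ 0 := by rw [G_succ']; simp
  have hpos : 0 < q ^ b - 1 := by rw [h1]; exact Nat.mul_pos hp.pos (Nat.pos_of_ne_zero hG0)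
  have hv : padicValNat p (q^b - 1) = 1 := by
    rw [h1, padicValNat.mul hp.ne_zero hG0, padicValNat_self, padicValNat.eq_zero_of_not_dvd hG]
  have hnd : ¬ p ∣ q ^ b := by
    rw [← h, ← Nat.Prime.coprime_iff_not_dvd hp]; exact (G_coprime p (a+1)).symm
  have h2 := padicValNat.pow_sub_pow (p := p) (x := q^b) (y := 1) hpo (by omega)
    (h1 ▸ dvd_mul_right _ _) hnd hD
  rw [hv, one_pow] at h2
  have h3 : p ^ e ∣ (q^b)^D - 1 := by
    refine hd.trans ?_
    rw [← pow_mul, mul_comm, pow_mul]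
    simpa using Nat.sub_dvd_pow_sub_pow (q^D) 1 b
  have hne : (q^b)^D - 1 ≠ 0 := by
    have : 1 < (q^b)^D := Nat.one_lt_pow hD (by omega)
    omega
  have h4 := (padicValNat_dvd_iff_le hne).1 h3
  exact (padicValNat_dvd_iff_le hD).2 (by omega)

lemma main_dvd (q α n c l : ℕ) (hq : q.Prime) (hqo : Odd q) (hno : Odd n)
    (hs : ArithmeticFunction.sigma 1 n = q ^ c) (hl : l = 1 ∨ l = 3 ∨ l = 5)
    (hd : n ∣ l * G q (α+1)) : n ∣ (α+1)^2 := by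
  have hn0 : n ≠ 0 := hno.pos.ne'
  rw [Nat.dvd_iff_prime_pow_dvd_dvd]
  intro p k hp hpk
  rcases Nat.eq_zero_or_pos k with rfl | hk
  · simp
  obtain ⟨a, n', hn', rfl⟩ := Nat.exists_eq_pow_mul_and_not_dvd hn0 p hp.ne_one
  have hka : k ≤ a := by
    have := (Nat.Coprime.dvd_of_dvd_mul_right (Nat.Coprime.pow_left k
      ((Nat.Prime.coprime_iff_not_dvd hp).2 hn')) hpk)
    exact (Nat.pow_dvd_pow_iff_le_right hp.one_lt).1 this
  refine (pow_dvd_pow p hka).trans ?_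
  have hpo : Odd p := by
    exact hno.of_dvd_nat ((dvd_pow_self p (by omega)).trans (dvd_mul_right _ n'))
  rw [sigma_split p a n' hp hn'] at hs
  obtain ⟨b, -, hb⟩ := (Nat.dvd_prime_pow hq).1 (Dvd.intro _ hs)
  have hae : (a+1) % 2 = 1 := by
    rw [← G_parity p (a+1) hpo, hb]; exact Nat.odd_iff.1 (hqo.pow)
  have ha2 : 2 ≤ a := by omega
  have hpa : p^a ∣ l * G q (α+1) := (dvd_mul_right _ _).trans hd
  have hGd := G_dvd q (α+1) hq.one_le
  by_cases hpl : p = l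
  · subst hpl
    have h1 : p^(a-1) ∣ G q (α+1) := by
      obtain ⟨a, rfl⟩ := Nat.exists_eq_add_of_le' (show 1 ≤ a by omega)
      rw [pow_succ'] at hpa
      exact Nat.dvd_of_mul_dvd_mul_left hp.pos hpa
    rcases eq_or_ne a 2 with rfl | ha
    · have hq1 : q ≡ 1 [MOD p] := by
        have key : ∀ P : ℕ, P.Prime → P = q ^ b → q = P := by
          intro P hP h
          have hb0 : b ≠ 0 := by rintro rfl; rw [pow_zero] at h; exact hP.ne_one h
          have := (Nat.prime_dvd_prime_iff_eq hq hP).1 (h ▸ dvd_pow_self q hb0)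
          exact this
        rcases hl with rfl | rfl | rfl
        · exact absurd hp (by norm_num)
        · rw [key 13 (by norm_num) (by rw [← hb]; rfl)]; rfl
        · rw [key 31 (by norm_num) (by rw [← hb]; rfl)]; rfl
      have h2 := G_modEq q (α+1) p hq1
      have h3 : p ∣ α + 1 := by
        rw [← (h2.dvd_iff dvd_rfl)]; simpa using h1
      exact pow_dvd_pow_of_dvd h3 2
    · have h2 := lift_exp p q a b (a-1) (α+1) hp hpo hq.two_le (by omega) (by omega) hb (h1.trans hGd)
      have h3 := pow_dvd_pow_of_dvd h2 2
      rw [← pow_mul] at h3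
      exact (pow_dvd_pow p (by omega)).trans h3
  · have hcop : Nat.Coprime p l := by
      rcases hl with rfl | rfl | rfl
      · simp
      · exact (Nat.coprime_primes hp (by norm_num)).2 hpl
      · exact (Nat.coprime_primes hp (by norm_num)).2 hpl
    have h1 := Nat.Coprime.dvd_of_dvd_mul_left (Nat.Coprime.pow_left a hcop) hpa
    have h2 := lift_exp p q a b a (α+1) hp hpo hq.two_le (by omega) (by omega) hb (h1.trans hGd)
    have h3 := pow_dvd_pow_of_dvd h2 2
    rw [← pow_mul] at h3
    exact (pow_dvd_pow p (by omega)).trans h3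

/-- size inequality for the exceptional prime -/
lemma exc_ineq (p q b r s : ℕ) (hp : 2 ≤ p) (hq : 3 ≤ q) (hs : 1 ≤ s) (hr : 1 ≤ r)
    (h : G p (s+1) = (s+1) * q^b) (hd : p^s ∣ q^(b+r) - 1) : b < r * s := by
  have h1 := G_succ p s
  obtain ⟨y, rfl⟩ := Nat.exists_eq_add_of_le' (show 1 ≤ p by omega)
  have h2 := G_eq y s
  have h3 := le_G (y+1) s (by omega)
  set P := (y+1)^s with hP
  set g := G (y+1) s with hg
  have hqr : 3 ≤ q^r := hq.trans (Nat.le_self_pow (by omega) q)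
  have h4 : (P:ℤ) ∣ (g:ℤ) * q^r - (s+1) := by
    have e1 : (P:ℤ) ∣ (q:ℤ)^(b+r) - 1 := by
      have := Int.natCast_dvd_natCast.2 hd
      rwa [Nat.cast_sub (Nat.one_le_pow _ _ (by omega)), Nat.cast_pow, Nat.cast_one] at this
    have e2 : (g:ℤ) + P = (s+1) * q^b := by exact_mod_cast h1.symm.trans h
    have e3 : (g:ℤ) * q^r - (s+1) = (s+1) * ((q:ℤ)^(b+r) - 1) - P * q^r := by
      rw [pow_add]; linear_combination (q:ℤ)^r * e2
    rw [e3]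
    exact dvd_sub (e1.mul_left _) (dvd_mul_right _ _)
  have h5 : s + 1 < g * q^r := by nlinarith
  have h6 : (P:ℤ) ≤ (g:ℤ) * q^r - (s+1) := Int.le_of_dvd (by
    have : ((s+1 : ℕ):ℤ) < (g * q^r : ℕ) := by exact_mod_cast h5
    push_cast at this; linarith) h4
  have h7 : P + (s+1) ≤ g * q^r := by zify; linarith
  have h8 : y < q^r := by
    by_contra hc
    push Not at hc
    have := Nat.mul_le_mul_left g hc
    nlinarith
  have h9 : P ≤ q^(r*s) := by rw [pow_mul]; exact Nat.pow_le_pow_left h8 s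
  have h10 : g < P := by nlinarith
  have h11 : 2 * q^b ≤ (s+1) * q^b := Nat.mul_le_mul_right _ (by omega)
  exact (Nat.pow_lt_pow_iff_right (by omega : 1 < q)).1 (by omega)

/-- the exceptional prime has exponent l - 1 -/
lemma exc_exp (p q a b l : ℕ) (hp : p.Prime) (hpo : Odd p) (hq : q.Prime) (hqo : Odd q)
    (hl : l = 2 ∨ l = 3 ∨ l = 5) (h : G p (a+1) = l * q^b) : a + 1 = l := by
  have hl2 : 2 ≤ l := by omega
  have hlG : l ∣ G p (a+1) := h ▸ dvd_mul_right _ _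
  have h2 : p ≡ 1 [MOD l] := by
    rcases eq_or_ne l 2 with rfl | hl2
    · exact odd_mod p hpo
    have hlo : Odd l := by rcases hl with rfl | rfl | rfl <;> first | decide | omega
    have ha : (a+1) % 2 = 1 := by
      rw [← G_parity p (a+1) hpo, h]; exact Nat.odd_iff.1 (hlo.mul hqo.pow)
    have hlp : l.Prime := by rcases hl with rfl | rfl | rfl <;> norm_num
    have h1 : p^(a+1) ≡ 1 [MOD l] := by
      have := (hlG.trans (G_dvd p (a+1) hp.one_le))
      exact ((Nat.modEq_iff_dvd' (Nat.one_le_pow _ _ hp.pos)).2 this).symm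
    have hF : Fact l.Prime := ⟨hlp⟩
    rw [← ZMod.natCast_eq_natCast_iff] at h1 ⊢
    push_cast at h1 ⊢
    have hne : (p : ZMod l) ≠ 0 := by
      intro h0; rw [h0, zero_pow (by omega)] at h1; exact zero_ne_one h1
    have h4 : (p : ZMod l)^4 = 1 := by
      have := ZMod.pow_card_sub_one_eq_one hne
      rcases hl with rfl | rfl | rfl
      · omega
      · rw [show 4 = (3-1)*2 by rfl, pow_mul, this, one_pow]
      · exact this
    have h5 : orderOf (p : ZMod l) ∣ a + 1 := orderOf_dvd_of_pow_eq_one h1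
    have h6 : orderOf (p : ZMod l) ∣ 4 := orderOf_dvd_of_pow_eq_one h4
    have hc : Nat.Coprime (a+1) 4 := by
      rw [show 4 = 2^2 by rfl]
      exact Nat.Coprime.pow_right 2 ((Nat.odd_iff.2 ha).coprime_two_right)
    exact orderOf_eq_one_iff.1 (Nat.eq_one_of_dvd_coprimes hc h5 h6)
  have hla : l ∣ a + 1 := ((G_modEq p (a+1) l h2).dvd_iff dvd_rfl).1 hlG
  obtain ⟨t, ht⟩ := hla
  have ht0 : t ≠ 0 := by rintro rfl; omega
  have hx : l ∣ G p l := ((G_modEq p l l h2).dvd_iff dvd_rfl).2 dvd_rfl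
  obtain ⟨x, hx⟩ := hx
  rw [ht, G_mul, hx, mul_assoc] at h
  have h' := Nat.eq_of_mul_eq_mul_left (by omega) h
  obtain ⟨i, -, hi⟩ := (Nat.dvd_prime_pow hq).1 (Dvd.intro _ h')
  obtain ⟨j, -, hj⟩ := (Nat.dvd_prime_pow hq).1 (Dvd.intro_left _ h')
  have hi0 : i ≠ 0 := by
    rintro rfl
    have := G_gt p l hp.two_le hl2
    rw [hx, hi] at this; simp at this
  have : q ∣ p^l - 1 := by
    refine (dvd_pow_self q hi0).trans (hi ▸ ?_)
    exact (Dvd.intro_left l hx.symm).trans (G_dvd p l hp.one_le)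
  have := repunit_pow (p^l) q t j (hp.two_le.trans (Nat.le_self_pow (by omega) p)) hq hqo this ht0 hj
  rw [ht, this, mul_one]

lemma exc_bound (q α m l : ℕ) (hα : 1 ≤ α) (hq : q.Prime) (hqo : Odd q) (hmo : Odd m)
    (hl : l = 2 ∨ l = 3 ∨ l = 5) (hlq : Nat.Coprime l q)
    (hs : ArithmeticFunction.sigma 1 m = l * q ^ α) (hG : l * G q (α+1) = 2 * m) :
    ∃ p n r, p.Prime ∧ p ≠ l ∧ m = p^(l-1) * n ∧ n ∣ (α+1)^2 ∧
      q^(r-1) < 2 * (α+1)^2 ∧ α + 1 < l * r := by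
  have hlp : l.Prime := by rcases hl with rfl | rfl | rfl <;> norm_num
  have hl2 := hlp.two_le
  have hm0 : m ≠ 0 := hmo.pos.ne'
  have hq3 : 3 ≤ q := by
    have := hq.two_le
    obtain ⟨k, hk⟩ := hqo
    omega
  obtain ⟨p, hp, hlG⟩ : ∃ p, p.Prime ∧ l ∣ G p (m.factorization p + 1) := by
    have h1 : l ∣ ArithmeticFunction.sigma 1 m := hs ▸ dvd_mul_right _ _
    rw [ArithmeticFunction.IsMultiplicative.multiplicative_factorization _
      ArithmeticFunction.isMultiplicative_sigma hm0, Finsupp.prod] at h1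
    obtain ⟨p, hp, h2⟩ := (Prime.dvd_finsetProd_iff hlp.prime _).1 h1
    have hp' : p.Prime := Nat.prime_of_mem_primeFactors (by simpa using hp)
    exact ⟨p, hp', by rwa [sigma_pow p _ hp'] at h2⟩
  set a := m.factorization p with ha
  obtain ⟨n, hn⟩ := Nat.ordProj_dvd m p
  have hpn : ¬ p ∣ n := by
    have h1 := Nat.not_dvd_ordCompl hp hm0
    rwa [show m / p ^ m.factorization p = n from
      Nat.div_eq_of_eq_mul_right (Nat.pow_pos hp.pos) hn] at h1
  rw [← ha] at hn
  have ha0 : a ≠ 0 := by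
    intro h; rw [h, zero_add, G_one] at hlG
    exact hlp.ne_one (Nat.dvd_one.1 hlG)
  have hpo : Odd p := hmo.of_dvd_nat ((dvd_pow_self p ha0).trans (hn ▸ dvd_mul_right _ n))
  have hno : Odd n := hmo.of_dvd_nat (hn ▸ dvd_mul_left n _)
  have hs' := hs
  rw [hn, sigma_split p a n hp hpn] at hs'
  obtain ⟨x, hx⟩ := hlG
  rw [hx, mul_assoc] at hs'
  have hs2 := Nat.eq_of_mul_eq_mul_left hlp.pos hs'
  obtain ⟨b, hb, rfl⟩ := (Nat.dvd_prime_pow hq).1 (Dvd.intro _ hs2)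
  obtain ⟨c, -, hc⟩ := (Nat.dvd_prime_pow hq).1 (Dvd.intro_left _ hs2)
  have hal := exc_exp p q a b l hp hpo hq hqo hl hx
  have hpl : p ≠ l := by
    rintro rfl
    have h1 := G_coprime p a
    rw [hx] at h1
    have := Nat.Coprime.coprime_dvd_left (dvd_mul_right p _) h1
    exact hp.ne_one ((Nat.coprime_self p).1 this)
  have hmG : m ∣ l * G q (α+1) := hG ▸ dvd_mul_left _ _
  have hnm : n ∣ m := hn ▸ dvd_mul_left _ _
  have hnd : n ∣ (α+1)^2 := by
    rcases hl with rfl | hl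
    · refine main_dvd q α n c 1 hq hqo hno hc (by simp) ?_
      have : G q (α+1) = m := by omega
      rw [one_mul, this]; exact hnm
    · exact main_dvd q α n c l hq hqo hno hc (Or.inr hl) (hnm.trans hmG)
  have hpG : p^a ∣ G q (α+1) := by
    have h1 : p^a ∣ l * G q (α+1) := (hn ▸ dvd_mul_right _ _ : p^a ∣ m).trans hmG
    exact Nat.Coprime.dvd_of_dvd_mul_left
      (Nat.Coprime.pow_left a ((Nat.coprime_primes hp hlp).2 hpl)) h1
  obtain ⟨r, hr⟩ := Nat.exists_eq_add_of_le (show b ≤ α + 1 by omega)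
  have hpd : p^a ∣ q^(b+r) - 1 := by
    rw [← hr]; exact hpG.trans (G_dvd q (α+1) hq.one_le)
  have hbr := exc_ineq p q b r a hp.two_le hq3 (by omega) (by omega) (by rw [hx, hal]) hpd
  refine ⟨p, n, r, hp, hpl, by rw [← hal]; exact hn, hnd, ?_, ?_⟩
  · have h1 : n ≤ (α+1)^2 := Nat.le_of_dvd (by positivity) hnd
    have h2 : p^a ≤ l * q^b := by rw [← hx, G_succ]; omega
    have h3 : q^α < G q (α+1) := by
      rw [G_succ]
      have := le_G q α hq.one_le
      omega
    have h4 : α = b + (r-1) := by omega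
    have h5 : l * q^α < l * (q^b * (2 * (α+1)^2)) := by
      calc l * q^α < l * G q (α+1) := Nat.mul_lt_mul_of_pos_left h3 hlp.pos
        _ = 2 * (p^a * n) := by rw [hG, ← hn]
        _ ≤ 2 * ((l * q^b) * (α+1)^2) := Nat.mul_le_mul_left _ (Nat.mul_le_mul h2 h1)
        _ = _ := by ring
    have h6 := Nat.lt_of_mul_lt_mul_left h5
    nth_rewrite 1 [h4] at h6
    rw [pow_add] at h6
    exact Nat.lt_of_mul_lt_mul_left h6
  · rw [hr, ← hal]; nlinarith

lemma G_even_mod (q α : ℕ) (hqo : Odd q) (m : ℕ) (hmo : Odd m) (l : ℕ) (hl : Odd l)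
    (hG : l * G q (α+1) = 2 * m) : (α+1) % 2 = 0 ∧ q % 4 = 1 := by
  have h1 : (α+1) % 2 = 0 := by
    rw [← G_parity q (α+1) hqo]
    have : Even (l * G q (α+1)) := hG ▸ even_two_mul m
    rcases Nat.even_mul.1 this with h | h
    · exact absurd h (Nat.not_even_iff_odd.2 hl)
    · exact Nat.even_iff.1 h
  refine ⟨h1, ?_⟩
  by_contra hne
  have hq4 : 4 ∣ q + 1 := by have := Nat.odd_iff.1 hqo; omega
  obtain ⟨t, ht⟩ := Nat.dvd_of_mod_eq_zero h1
  have h2 : q + 1 ∣ G q (α+1) := by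
    rw [ht, G_mul, show G q 2 = q + 1 by simp [G, Finset.sum_range_succ, add_comm]]
    exact dvd_mul_right _ _
  have h3 : 4 ∣ 2 * m := hG ▸ (hq4.trans h2).mul_left l
  have := Nat.odd_iff.1 hmo
  omega

lemma poly_bound (c x u0 u : ℕ) (hx : 4 ≤ x) (hu0 : 1 ≤ u0) (h0 : c * u0^2 ≤ x^u0) (hu : u0 ≤ u) :
    c * u^2 ≤ x^u := by
  induction u, hu using Nat.le_induction with
  | base => exact h0
  | succ k hk ih =>
    rw [pow_succ]
    calc c * (k+1)^2 ≤ c * (k^2 * 4) := Nat.mul_le_mul_left _ (by nlinarith)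
      _ = c * k^2 * 4 := by ring
      _ ≤ _ := Nat.mul_le_mul ih hx

lemma case_one (q α m : ℕ) (hq : q.Prime) (hqo : Odd q) (hmo : Odd m) (hα : 1 ≤ α)
    (hs : ArithmeticFunction.sigma 1 m = q ^ α) (hG : G q (α+1) = 2 * m) : False := by
  obtain ⟨h1, h2⟩ := G_even_mod q α hqo m hmo 1 (by decide) (by simpa using hG)
  have hd := main_dvd q α m α 1 hq hqo hmo hs (by simp) (by rw [one_mul, hG]; exact dvd_mul_left _ _)
  have hq5 : 5 ≤ q := by have := hq.two_le; omega
  rcases eq_or_ne α 1 with rfl | hα1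
  · have : m = 1 := by
      have hc : Nat.Coprime m ((1+1)^2) := Nat.Coprime.pow_right 2 hmo.coprime_two_right
      exact Nat.Coprime.eq_one_of_dvd hc hd
    subst this
    simp [G, Finset.sum_range_succ] at hG
    omega
  · have h3 : q^α < G q (α+1) := by
      rw [G_succ]
      have := le_G q α hq.one_le
      omega
    have h4 := Nat.le_of_dvd (by positivity) hd
    have h5 := Nat.pow_le_pow_left hq5 α
    have h6 := poly_bound 8 5 3 α (by norm_num) (by norm_num) (by norm_num) (by omega)
    nlinarith

lemma case_two (q α m : ℕ) (hq : q.Prime) (hqo : Odd q) (hmo : Odd m) (hα : 1 ≤ α)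
    (hs : ArithmeticFunction.sigma 1 m = 2 * q ^ α) (hG : 2 * G q (α+1) = 2 * m) : False := by
  obtain ⟨p, n, r, hp, hpl, hm, hn, hb, hr⟩ := exc_bound q α m 2 hα hq hqo hmo (by simp)
    hqo.coprime_two_left hs hG
  have hGm : G q (α+1) = m := by omega
  have h1 : (α+1) % 2 = 1 := by
    rw [← G_parity q (α+1) hqo, hGm]; exact Nat.odd_iff.1 hmo
  obtain ⟨u, rfl⟩ : ∃ u, α = 2 * u := ⟨α/2, by omega⟩
  have hb2 : q^u < 2 * (2*u+1)^2 := (Nat.pow_le_pow_right hq.pos (by omega)).trans_lt hb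
  have hq3 : 3 ≤ q := by
    have := hq.two_le
    have := Nat.odd_iff.1 hqo
    omega
  have hu : u < 5 := by
    by_contra hc
    have h5 := Nat.pow_le_pow_left hq3 u
    have h6 : 2 * (2*u+1)^2 ≤ 3^u := by
      have hc' : 5 ≤ u := by omega
      clear * - hc'
      induction u, hc' using Nat.le_induction with
      | base => norm_num
      | succ k hk ih => rw [pow_succ 3 k]; nlinarith
    omega
  rw [← hGm] at hs
  have hq18 : q < 18 := by
    by_contra hc
    have h5 := Nat.pow_le_pow_left (show 18 ≤ q by omega) u
    interval_cases u <;> omega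
  clear hr hb hm hn hG hGm hmo hpl hp
  interval_cases u <;> first | omega | skip
  all_goals
    interval_cases q <;> first
      | (exfalso; revert hq; norm_num; done)
      | (exfalso; revert hb2; norm_num; done)
      | (exfalso; revert hs; decide +kernel)

lemma case_odd (q α m l : ℕ) (hα : 1 ≤ α) (hq : q.Prime) (hqo : Odd q) (hmo : Odd m)
    (hl : l = 3 ∨ l = 5) (hlm : l ∣ m) (hlq : Nat.Coprime l q)
    (hs : ArithmeticFunction.sigma 1 m = l * q ^ α) (hG : l * G q (α+1) = 2 * m) : False := by
  obtain ⟨p, n, r, hp, hpl, hm, hn, hb, hr⟩ := exc_bound q α m l hα hq hqo hmo (Or.inr hl)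
    hlq hs hG
  have hlp : l.Prime := by rcases hl with rfl | rfl <;> norm_num
  have hlo : Odd l := by rcases hl with rfl | rfl <;> decide
  obtain ⟨h1, h2⟩ := G_even_mod q α hqo m hmo l hlo hG
  have hla : l ∣ α + 1 := by
    have h3 : l ∣ n := by
      rw [hm] at hlm
      refine Nat.Coprime.dvd_of_dvd_mul_left (Nat.Coprime.pow_right _ ?_) hlm
      exact (Nat.coprime_primes hlp hp).2 (Ne.symm hpl)
    exact hlp.dvd_of_dvd_pow (h3.trans hn)
  obtain ⟨u, hu⟩ := hla
  have hue : u % 2 = 0 := by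
    rcases hl with rfl | rfl <;> omega
  have hu0 : u ≠ 0 := by rintro rfl; omega
  have hur : u < r := by rw [hu] at hr; exact Nat.lt_of_mul_lt_mul_left hr
  have hb2 : q^u < 2 * (l*u)^2 := by
    rw [← hu]; exact (Nat.pow_le_pow_right hq.pos (by omega)).trans_lt hb
  have hq5 : 5 ≤ q := by have := hq.two_le; omega
  rcases hl with rfl | rfl
  · have hu2 : u = 2 := by
      by_contra hc
      have h5 := Nat.pow_le_pow_left hq5 u
      have h6 := poly_bound 18 5 4 u (by norm_num) (by norm_num) (by norm_num) (by omega)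
      nlinarith
    subst hu2
    obtain rfl : α = 5 := by omega
    obtain rfl : q = 5 := by
      have : q < 9 := by nlinarith
      omega
    obtain rfl : m = 5859 := by
      rw [show G 5 (5+1) = 3906 by rfl] at hG; omega
    revert hs; decide +kernel
  · have hq13 : 13 ≤ q := by
      by_contra hc
      have : q = 5 ∨ q = 9 := by omega
      rcases this with rfl | rfl
      · revert hlq; norm_num
      · revert hq; norm_num
    have hu2 : u = 2 := by
      by_contra hc
      have h5 := Nat.pow_le_pow_left hq13 u
      have h6 := poly_bound 50 13 4 u (by norm_num) (by norm_num) (by norm_num) (by omega)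
      nlinarith
    subst hu2
    obtain rfl : α = 9 := by omega
    obtain rfl : q = 13 := by
      have : q < 15 := by nlinarith
      omega
    have hGv : G 13 (9+1) = 11488207654 := by decide +kernel
    rw [hGv] at hG
    have hmv : m = 28720519135 := by omega
    have h7 : 7 ∣ p^(5-1) * n := by rw [← hm, hmv]; norm_num
    have h7p : Nat.Prime 7 := by norm_num
    rcases (Nat.Prime.dvd_mul h7p).1 h7 with h | h
    · have := (Nat.prime_dvd_prime_iff_eq h7p hp).1 (h7p.dvd_of_dvd_pow h)
      subst this
      omega
    · have := h.trans hn
      revert this; norm_num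

theorem opn_ratio_gt_five (N q α : ℕ) (hN : N.Perfect) (hNodd : Odd N)
    (hq : q.Prime) (hα : 1 ≤ α)
    (hdvd : q ^ α ∣ N) (hndvd : ¬ q ^ (α + 1) ∣ N) :
    5 < (ArithmeticFunction.sigma 1 (N / q ^ α)) / q ^ α := by
  obtain ⟨m, rfl⟩ := hdvd
  have hqpos : 0 < q^α := Nat.pow_pos hq.pos
  rw [Nat.mul_div_cancel_left _ hqpos]
  have hqm : ¬ q ∣ m := fun h => hndvd (by rw [pow_succ]; exact Nat.mul_dvd_mul_left _ h)
  have hqo : Odd q := hNodd.of_dvd_nat ((dvd_pow_self q (by omega)).trans (dvd_mul_right _ m))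
  have hmo : Odd m := hNodd.of_dvd_nat (dvd_mul_left _ _)
  have h1 := (Nat.perfect_iff_sum_divisors_eq_two_mul hN.2).1 hN
  rw [← ArithmeticFunction.sigma_one_apply, sigma_split q α m hq hqm] at h1
  have h2 : q^α ∣ ArithmeticFunction.sigma 1 m := by
    refine Nat.Coprime.dvd_of_dvd_mul_left (Nat.Coprime.pow_left α (G_coprime q α).symm) ?_
    rw [h1]; exact ⟨2 * m, by ring⟩
  obtain ⟨k, hk⟩ := h2
  rw [hk, Nat.mul_div_cancel_left _ hqpos]
  have hG : k * G q (α+1) = 2 * m := by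
    rw [hk] at h1
    apply Nat.eq_of_mul_eq_mul_left hqpos
    linarith
  rw [mul_comm] at hk
  by_contra hc
  have hodd := Nat.odd_iff.1 hmo
  have hcase : ∀ l, (l = 3 ∨ l = 5) → k = l → False := by
    intro l hl hkl
    subst hkl
    have hlp : k.Prime := by rcases hl with rfl | rfl <;> norm_num
    have hkm : k ∣ m := by
      refine Nat.Coprime.dvd_of_dvd_mul_left (k := k) (m := 2) ?_ (hG ▸ dvd_mul_right _ _)
      rcases hl with rfl | rfl <;> norm_num
    refine case_odd q α m k hα hq hqo hmo hl hkm ?_ hk hG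
    refine (Nat.coprime_primes hlp hq).2 ?_
    rintro rfl
    exact hqm hkm
  have : k ≤ 5 := by omega
  interval_cases k
  · omega
  · exact case_one q α m hq hqo hmo hα (by simpa using hk) (by simpa using hG)
  · exact case_two q α m hq hqo hmo hα hk hG
  · exact hcase 3 (by simp) rfl
  · omega
  · exact hcase 5 (by simp) rfl
end

section
/- Any odd perfect number with s distinct prime factors is less than 4^(4^(s+1)). -/
/-- Sorted-free Weierstrass type inequality. -/
lemma hb_comb (x : ℕ → ℕ) (c : ℕ) (hc : 1 ≤ c) (s : Finset ℕ) :
    (∀ i ∈ s, 1 ≤ x i) → (∀ j, 1 ≤ j → (s.filter (fun i => x i ≤ 2 ^ j * c)).card < j) →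
    (1 - (1 - 1 / 2 ^ s.card) / c : ℚ) ≤ ∏ i ∈ s, (1 - 1 / (x i : ℚ)) ∧
      ∏ i ∈ s, (1 - 1 / (x i : ℚ)) ≤ 1 := by
  induction s using Finset.induction_on_max_value x with
  | empty => intro _ _; simp
  | insert a s ha hmax ih =>
    intro hx h
    obtain ⟨ih1, ih2⟩ := ih (fun i hi => hx i (Finset.mem_insert_of_mem hi)) (by
      intro j hj
      refine lt_of_le_of_lt (Finset.card_le_card ?_) (h j hj)
      exact Finset.filter_subset_filter _ (Finset.subset_insert _ _))
    have hbig : 2 ^ (s.card + 1) * c < x a := by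
      by_contra hcon
      push Not at hcon
      have h1 := h (s.card + 1) (by omega)
      rw [Finset.filter_true_of_mem, Finset.card_insert_of_notMem ha] at h1
      · omega
      · intro i hi
        rcases Finset.mem_insert.1 hi with rfl | hi
        · exact hcon
        · exact (hmax i hi).trans hcon
    have hcq : (1 : ℚ) ≤ c := by exact_mod_cast hc
    have hxa : (1 : ℚ) ≤ x a := by exact_mod_cast hx a (Finset.mem_insert_self _ _)
    have hbq : (2 ^ (s.card + 1) * c : ℚ) ≤ x a := by exact_mod_cast hbig.le
    have hpos : (0 : ℚ) < 2 ^ (s.card + 1) * c := by positivity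
    have hle : 1 / (x a : ℚ) ≤ 1 / (2 ^ (s.card + 1) * c) := one_div_le_one_div_of_le hpos hbq
    have h0 : 0 ≤ 1 / (x a : ℚ) := by positivity
    have h1 : 1 / (x a : ℚ) ≤ 1 := by
      rw [div_le_one (by linarith)]; exact hxa
    rw [Finset.prod_insert ha, Finset.card_insert_of_notMem ha]
    set Q := ∏ i ∈ s, (1 - 1 / (x i : ℚ)) with hQ
    have hQ0 : 0 ≤ Q := by
      apply Finset.prod_nonneg
      intro i hi
      have : (1 : ℚ) ≤ x i := by exact_mod_cast hx i (Finset.mem_insert_of_mem hi)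
      have : 1 / (x i : ℚ) ≤ 1 := by
        rw [div_le_one (by linarith)]; exact this
      linarith
    constructor
    · have e : (1 - (1 - 1 / 2 ^ (s.card + 1)) / c : ℚ)
          = (1 - (1 - 1 / 2 ^ s.card) / c) - 1 / (2 ^ (s.card + 1) * c) := by
        field_simp
        ring
      rw [e]
      nlinarith
    · nlinarith

lemma hb_exp (j : ℕ) (hj : 1 ≤ j) : 2 + j * (j + 1) ≤ 2 * 2 ^ j := by
  induction j, hj using Nat.le_induction with
  | base => norm_num
  | succ n hn ih =>
    rcases Nat.lt_or_ge n 3 with h | h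
    · interval_cases n <;> norm_num
    · rw [pow_succ]; nlinarith

lemma hb_step (x : ℕ → ℕ) (B : ℕ) (hB : 1 ≤ B) (s : Finset ℕ) (hx : ∀ i ∈ s, 1 ≤ x i)
    (h : ∏ i ∈ s, (1 - 1 / (x i : ℚ)) ≤ B / (B + 1)) :
    ∃ V ⊆ s, 1 ≤ V.card ∧ 4 * (B * ∏ i ∈ V, x i) ≤ (4 * B) ^ 2 ^ V.card := by
  by_cases hj : ∀ j, 1 ≤ j → (s.filter (fun i => x i ≤ 2 ^ j * (B + 1))).card < j
  · exfalso
    have := (hb_comb x (B + 1) (by omega) s hx hj).1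
    have h2 : (B : ℚ) / (B + 1) = 1 - 1 / (B + 1) := by field_simp; ring
    have h3 : (1 - 1 / 2 ^ s.card : ℚ) / ((B + 1 : ℕ) : ℚ) < 1 / (B + 1) := by
      push_cast
      apply div_lt_div_of_pos_right _ (by positivity)
      have : (0 : ℚ) < 1 / 2 ^ s.card := by positivity
      linarith
    linarith
  · push Not at hj
    obtain ⟨j, hj1, hj2⟩ := hj
    obtain ⟨V, hV, hVc⟩ := Finset.exists_subset_card_eq hj2
    refine ⟨V, hV.trans (Finset.filter_subset _ _), by omega, ?_⟩
    have hprod : ∏ i ∈ V, x i ≤ (2 ^ (j + 1) * B) ^ j := by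
      rw [← hVc]
      apply Finset.prod_le_pow_card
      intro i hi
      have := (Finset.mem_filter.1 (hV hi)).2
      rw [hVc, pow_succ]
      nlinarith [Nat.one_le_two_pow (n := j)]
    rw [hVc]
    have he := hb_exp j hj1
    have hj3 : j + 1 ≤ 2 ^ j := Nat.lt_two_pow_self
    calc 4 * (B * ∏ i ∈ V, x i) ≤ 4 * (B * (2 ^ (j + 1) * B) ^ j) := by gcongr
      _ = 2 ^ (2 + j * (j + 1)) * B ^ (j + 1) := by
        rw [mul_pow, ← pow_mul, pow_add, pow_succ B j, mul_comm (j + 1) j]; ring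
      _ ≤ 2 ^ (2 * 2 ^ j) * B ^ (2 ^ j) :=
        Nat.mul_le_mul (Nat.pow_le_pow_right (by norm_num) he) (Nat.pow_le_pow_right hB hj3)
      _ = (4 * B) ^ 2 ^ j := by rw [mul_pow, pow_mul]; norm_num

lemma hb_core (P : Finset ℕ) (f g : ℕ → ℕ) (hp : ∀ p ∈ P, 3 ≤ p ∧ Odd p)
    (hf : ∀ p ∈ P, 1 ≤ f p) (hfo : ∀ p ∈ P, Odd (f p))
    (hg : ∀ p ∈ P, (p - 1) * g p + 1 = p * f p) (hlt : ∀ p ∈ P, f p < g p)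
    (htot : ∏ p ∈ P, g p = 2 * ∏ p ∈ P, f p) (n : ℕ) :
    ∀ T U : Finset ℕ, T ⊆ P → U ⊆ P → Disjoint T U → 2 * P.card ≤ n + (2 * T.card + U.card) →
      4 * ((∏ p ∈ T, g p) * ∏ p ∈ U, p) ≤ 4 ^ 2 ^ (2 * T.card + U.card) →
      4 * ∏ p ∈ P, g p ≤ 4 ^ 2 ^ (2 * P.card) := by
  induction n using Nat.strong_induction_on with
  | _ n ih =>
  intro T U hT hU hd hn hinv
  by_cases hTP : T = P
  · subst hTP
    have hU0 : U = ∅ := by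
      rw [← Finset.subset_empty]
      intro a ha
      exact absurd ha (Finset.disjoint_left.1 hd (hU ha))
    subst hU0
    simpa using hinv
  have hdU : ∀ p ∈ P, (1 - 1 / (p : ℚ)) = f p / g p * (1 - 1 / ((p * f p : ℕ) : ℚ)) := by
    intro p h
    have h1 := hg p h
    have h3 := (hp p h).1
    have hf1 := hf p h
    have hl := hlt p h
    have e : ((p : ℚ) - 1) * g p + 1 = p * f p := by
      have := congrArg (Nat.cast : ℕ → ℚ) h1
      push_cast [Nat.cast_sub (show 1 ≤ p by omega)] at this
      exact this
    have p0 : (p : ℚ) ≠ 0 := by exact_mod_cast (show p ≠ 0 by omega)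
    have f0 : (f p : ℚ) ≠ 0 := by exact_mod_cast (show f p ≠ 0 by omega)
    have g0 : (g p : ℚ) ≠ 0 := by exact_mod_cast (show g p ≠ 0 by omega)
    push_cast
    field_simp
    linarith
  have hu0 : ∀ p ∈ P, (0 : ℚ) < f p / g p := by
    intro p h
    have hf1 := hf p h
    have hl := hlt p h
    have f0 : (0 : ℚ) < f p := by exact_mod_cast (show 0 < f p by omega)
    have g0 : (0 : ℚ) < g p := by exact_mod_cast (show 0 < g p by omega)
    positivity
  have hu1 : ∀ p ∈ P, (f p / g p : ℚ) < 1 := by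
    intro p h
    have hl := hlt p h
    have g0 : (0 : ℚ) < g p := by exact_mod_cast (show 0 < g p by omega)
    rw [div_lt_one g0]
    exact_mod_cast hl
  have hx0 : ∀ p ∈ P, (0 : ℚ) ≤ 1 - 1 / ((p * f p : ℕ) : ℚ) ∧ 1 - 1 / ((p * f p : ℕ) : ℚ) ≤ 1 := by
    intro p h
    have : 1 ≤ p * f p := Nat.mul_pos (by have := (hp p h).1; omega) (hf p h)
    have h1 : (1 : ℚ) ≤ (p * f p : ℕ) := by exact_mod_cast this
    have h2 : 1 / ((p * f p : ℕ) : ℚ) ≤ 1 := by rw [div_le_one (by linarith)]; exact h1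
    have h3 : 0 ≤ 1 / ((p * f p : ℕ) : ℚ) := by positivity
    constructor <;> linarith
  have hv0 : ∀ p ∈ P, (0 : ℚ) ≤ 1 - 1 / (p : ℚ) := by
    intro p h
    rw [hdU p h]
    exact mul_nonneg (hu0 p h).le (hx0 p h).1
  have hvu : ∀ p ∈ P, 1 - 1 / (p : ℚ) ≤ f p / g p := by
    intro p h
    rw [hdU p h]
    exact mul_le_of_le_one_right (hu0 p h).le (hx0 p h).2
  set W := P \ (T ∪ U) with hW
  have hWP : W ⊆ P := Finset.sdiff_subset
  set A := 2 * (∏ p ∈ T, f p) * ∏ p ∈ U, (p - 1) with hA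
  set B := (∏ p ∈ T, g p) * ∏ p ∈ U, p with hBdef
  have hB1 : 1 ≤ B := by
    apply Nat.mul_pos
    · exact Finset.prod_pos fun p h => by have := hlt p (hT h); omega
    · exact Finset.prod_pos fun p h => by have := (hp p (hU h)).1; omega
  have hBq : (0 : ℚ) < B := by exact_mod_cast hB1
  -- split of the total product
  have hsplit : ∀ φ : ℕ → ℚ, ∏ p ∈ P, φ p = (∏ p ∈ T, φ p) * (∏ p ∈ U, φ p) * ∏ p ∈ W, φ p := by
    intro φ
    rw [← Finset.prod_union hd, mul_comm, Finset.prod_sdiff (Finset.union_subset hT hU)]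
  have htotq : 2 * ((∏ p ∈ T, (f p / g p : ℚ)) * (∏ p ∈ U, (f p / g p : ℚ)) *
      ∏ p ∈ W, (f p / g p : ℚ)) = 1 := by
    rw [← hsplit, Finset.prod_div_distrib]
    have h1 : (∏ p ∈ P, (g p : ℚ)) = 2 * ∏ p ∈ P, (f p : ℚ) := by exact_mod_cast htot
    have h2 : (∏ p ∈ P, (f p : ℚ)) ≠ 0 := by
      rw [Finset.prod_ne_zero_iff]
      intro p h
      have := hf p h
      exact_mod_cast (show f p ≠ 0 by omega)
    rw [h1]
    field_simp
  have hAB : (A : ℚ) / B = 2 * (∏ p ∈ T, (f p / g p : ℚ)) * ∏ p ∈ U, (1 - 1 / (p : ℚ)) := by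
    have e1 : ∏ p ∈ U, (1 - 1 / (p : ℚ)) = (∏ p ∈ U, ((p - 1 : ℕ) : ℚ)) / ∏ p ∈ U, (p : ℚ) := by
      rw [← Finset.prod_div_distrib]
      apply Finset.prod_congr rfl
      intro p h
      have := (hp p (hU h)).1
      have p0 : (p : ℚ) ≠ 0 := by exact_mod_cast (show p ≠ 0 by omega)
      rw [Nat.cast_sub (by omega)]
      field_simp
      simp
    rw [e1, Finset.prod_div_distrib, hA, hBdef]
    push_cast
    rw [mul_div_assoc' 2, div_mul_div_comm]
  have hT0 : 0 < ∏ p ∈ T, (f p / g p : ℚ) := Finset.prod_pos fun p h => hu0 p (hT h)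
  have hU0 : 0 < ∏ p ∈ U, (f p / g p : ℚ) := Finset.prod_pos fun p h => hu0 p (hU h)
  have hW0 : 0 < ∏ p ∈ W, (f p / g p : ℚ) := Finset.prod_pos fun p h => hu0 p (hWP h)
  have hW1 : ∏ p ∈ W, (f p / g p : ℚ) ≤ 1 :=
    Finset.prod_le_one (fun p h => (hu0 p (hWP h)).le) fun p h => (hu1 p (hWP h)).le
  rcases lt_trichotomy A B with hAltB | heq | hgt
  · -- learn some exponents
    have hkey : ∏ p ∈ U, (1 - 1 / ((p * f p : ℕ) : ℚ)) ≤ B / (B + 1) := by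
      have e2 : ∏ p ∈ U, (1 - 1 / (p : ℚ)) =
          (∏ p ∈ U, (f p / g p : ℚ)) * ∏ p ∈ U, (1 - 1 / ((p * f p : ℕ) : ℚ)) := by
        rw [← Finset.prod_mul_distrib]
        exact Finset.prod_congr rfl fun p h => hdU p (hU h)
      rw [e2] at hAB
      have hX0 : 0 ≤ ∏ p ∈ U, (1 - 1 / ((p * f p : ℕ) : ℚ)) :=
        Finset.prod_nonneg fun p h => (hx0 p (hU h)).1
      set X := ∏ p ∈ U, (1 - 1 / ((p * f p : ℕ) : ℚ))
      have h1 : X ≤ A / B := by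
        rw [hAB]
        set t := ∏ p ∈ T, (f p / g p : ℚ)
        set u := ∏ p ∈ U, (f p / g p : ℚ)
        set w := ∏ p ∈ W, (f p / g p : ℚ)
        have : 1 ≤ 2 * (t * u) := by
          have : 0 < t * u := mul_pos hT0 hU0
          nlinarith
        calc X = 1 * X := (one_mul _).symm
          _ ≤ 2 * (t * u) * X := by gcongr
          _ = _ := by ring
      refine h1.trans ?_
      rw [div_le_div_iff₀ hBq (by linarith)]
      have : (A : ℚ) + 1 ≤ B := by exact_mod_cast hAltB
      nlinarith
    obtain ⟨V, hV, hVc, hVb⟩ := hb_step (fun p => p * f p) B hB1 U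
      (fun p h => Nat.mul_pos (by have := (hp p (hU h)).1; omega) (hf p (hU h))) hkey
    have hTV : Disjoint T V := Finset.disjoint_of_subset_right hV hd
    have hcT : (T ∪ V).card = T.card + V.card := Finset.card_union_of_disjoint hTV
    have hcU : (U \ V).card + V.card = U.card := Finset.card_sdiff_add_card_eq_card hV
    have hVle : T.card + V.card ≤ P.card := by
      rw [← hcT]; exact Finset.card_le_card (Finset.union_subset hT (hV.trans hU))
    have hUle : T.card + U.card ≤ P.card := by
      rw [← Finset.card_union_of_disjoint hd]; exact Finset.card_le_card (Finset.union_subset hT hU)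
    have hexp : 2 * (T ∪ V).card + (U \ V).card = 2 * T.card + U.card + V.card := by omega
    refine ih (n - V.card) (by omega) (T ∪ V) (U \ V) (Finset.union_subset hT (hV.trans hU))
      (Finset.sdiff_subset.trans hU) ?_ (by omega) ?_
    · rw [Finset.disjoint_union_left]
      exact ⟨Finset.disjoint_of_subset_right Finset.sdiff_subset hd, Finset.disjoint_sdiff⟩
    · rw [hexp, pow_add 2, pow_mul, Finset.prod_union hTV]
      refine le_trans ?_ (hVb.trans (Nat.pow_le_pow_left hinv _))
      have h1 : ∏ p ∈ V, g p ≤ ∏ p ∈ V, p * f p := by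
        apply Finset.prod_le_prod'
        intro p h
        have a1 := hg p (hU (hV h))
        have a2 := (hp p (hU (hV h))).1
        have a3 : 1 * g p ≤ (p - 1) * g p := Nat.mul_le_mul_right _ (by omega)
        omega
      have h2 : ∏ p ∈ U \ V, p ≤ ∏ p ∈ U, p := by
        apply Finset.prod_le_prod_of_subset_of_one_le' Finset.sdiff_subset
        intro p h _
        have := (hp p (hU h)).1
        omega
      calc 4 * ((∏ p ∈ T, g p) * (∏ p ∈ V, g p) * ∏ p ∈ U \ V, p)
          ≤ 4 * ((∏ p ∈ T, g p) * (∏ p ∈ V, p * f p) * ∏ p ∈ U, p) := by gcongr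
        _ = _ := by rw [hBdef]; ring
  · -- impossible
    exfalso
    rcases U.eq_empty_or_nonempty with hUe | ⟨q, hq⟩
    · subst hUe
      have h1 : (A : ℚ) / B = 1 := by rw [heq]; exact div_self hBq.ne'
      rw [h1] at hAB
      simp only [Finset.prod_empty, mul_one] at hAB htotq
      have hWne : W.Nonempty := by
        rw [hW, Finset.sdiff_nonempty]
        intro h
        apply hTP
        apply Finset.Subset.antisymm hT
        simpa using h
      have : ∏ p ∈ W, (f p / g p : ℚ) < ∏ p ∈ W, (1 : ℚ) :=
        Finset.prod_lt_prod_of_nonempty (fun p h => hu0 p (hWP h)) (fun p h => hu1 p (hWP h)) hWne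
      rw [Finset.prod_const_one] at this
      nlinarith
    · have h4 : 4 ∣ A := by
        have h2 : 2 ∣ ∏ p ∈ U, (p - 1) := by
          refine dvd_trans ?_ (Finset.dvd_prod_of_mem (fun p => p - 1) hq)
          obtain ⟨k, hk⟩ := (hp q (hU hq)).2
          exact ⟨k, by omega⟩
        obtain ⟨m, hm⟩ := h2
        rw [hA, hm]
        exact ⟨(∏ p ∈ T, f p) * m, by ring⟩
      rw [heq] at h4
      have hdv : B ∣ 2 * ((∏ p ∈ P, f p) * ∏ p ∈ U, p) := by
        rw [hBdef, ← mul_assoc, ← htot]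
        exact mul_dvd_mul_right (Finset.prod_dvd_prod_of_subset _ _ _ hT) _
      have hodd : Odd ((∏ p ∈ P, f p) * ∏ p ∈ U, p) := by
        apply Odd.mul
        · exact Finset.prod_induction _ Odd (fun _ _ => Odd.mul) odd_one hfo
        · exact Finset.prod_induction _ Odd (fun _ _ => Odd.mul) odd_one
            fun p h => (hp p (hU h)).2
      have := h4.trans hdv
      obtain ⟨k, hk⟩ := hodd
      omega
  · -- learn some primes
    have hkey : ∏ p ∈ W, (1 - 1 / (p : ℚ)) ≤ B / (B + 1) := by
      have h1 : ∏ p ∈ W, (1 - 1 / (p : ℚ)) ≤ ∏ p ∈ W, (f p / g p : ℚ) :=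
        Finset.prod_le_prod (fun p h => hv0 p (hWP h)) fun p h => hvu p (hWP h)
      have h2 : ∏ p ∈ U, (1 - 1 / (p : ℚ)) ≤ ∏ p ∈ U, (f p / g p : ℚ) :=
        Finset.prod_le_prod (fun p h => hv0 p (hU h)) fun p h => hvu p (hU h)
      have h0 : 0 ≤ ∏ p ∈ W, (1 - 1 / (p : ℚ)) := Finset.prod_nonneg fun p h => hv0 p (hWP h)
      refine h1.trans ?_
      set t := ∏ p ∈ T, (f p / g p : ℚ)
      set u := ∏ p ∈ U, (f p / g p : ℚ)
      set w := ∏ p ∈ W, (f p / g p : ℚ)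
      have h3 : (A : ℚ) / B * w ≤ 1 := by
        rw [hAB]
        calc 2 * t * (∏ p ∈ U, (1 - 1 / (p : ℚ))) * w ≤ 2 * t * u * w := by gcongr
          _ = 1 := by linarith
      have h4 : (B : ℚ) + 1 ≤ A := by exact_mod_cast hgt
      rw [div_mul_eq_mul_div, div_le_one hBq] at h3
      rw [le_div_iff₀ (by linarith)]
      nlinarith
    obtain ⟨V, hV, hVc, hVb⟩ := hb_step (fun p => p) B hB1 W
      (fun p h => by have := (hp p (hWP h)).1; omega) hkey
    have hTW : Disjoint (T ∪ U) V := Finset.disjoint_of_subset_right hV Finset.disjoint_sdiff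
    rw [Finset.disjoint_union_left] at hTW
    have hcU : (U ∪ V).card = U.card + V.card := Finset.card_union_of_disjoint hTW.2
    have hdis : Disjoint T (U ∪ V) := by
      rw [Finset.disjoint_union_right]; exact ⟨hd, hTW.1⟩
    have hUV : U ∪ V ⊆ P := Finset.union_subset hU (hV.trans hWP)
    have hle : T.card + (U ∪ V).card ≤ P.card := by
      rw [← Finset.card_union_of_disjoint hdis]
      exact Finset.card_le_card (Finset.union_subset hT hUV)
    have hexp : 2 * T.card + (U ∪ V).card = 2 * T.card + U.card + V.card := by omega
    refine ih (n - V.card) (by omega) T (U ∪ V) hT hUV hdis (by omega) ?_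
    rw [hexp, pow_add 2, pow_mul, Finset.prod_union hTW.2, ← mul_assoc (∏ p ∈ T, g p)]
    exact hVb.trans (Nat.pow_le_pow_left hinv _)

theorem heath_brown_bound (N : ℕ) (hN : N.Perfect) (hNodd : Odd N) :
    N < 4 ^ 4 ^ (N.primeFactors.card + 1) := by
  have hpos : 0 < N := hN.2
  have hsig : ∑ d ∈ N.divisors, d = 2 * N := (Nat.perfect_iff_sum_divisors_eq_two_mul hpos).1 hN
  have hprod : ∏ p ∈ N.primeFactors, p ^ N.factorization p = N :=
    Nat.prod_factorization_pow_eq_self hpos.ne'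
  have hs : ∏ p ∈ N.primeFactors, (∑ k ∈ Finset.range (N.factorization p + 1), p ^ k)
      = 2 * N := by
    rw [← hsig, Nat.sum_divisors hpos.ne']
  have hodd : ∀ p ∈ N.primeFactors, Odd p := fun p h =>
    Odd.of_dvd_nat hNodd (Nat.dvd_of_mem_primeFactors h)
  have h3 : ∀ p ∈ N.primeFactors, 3 ≤ p := by
    intro p h
    have h2 := (Nat.prime_of_mem_primeFactors h).two_le
    obtain ⟨k, hk⟩ := hodd p h
    omega
  have hcore := hb_core N.primeFactors (fun p => p ^ N.factorization p)
    (fun p => ∑ k ∈ Finset.range (N.factorization p + 1), p ^ k)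
    (fun p h => ⟨h3 p h, hodd p h⟩)
    (fun p h => Nat.pow_pos (by have := h3 p h; omega))
    (fun p h => (hodd p h).pow)
    (by
      intro p h
      have := h3 p h
      obtain ⟨q, rfl⟩ : ∃ q, p = q + 1 := ⟨p - 1, by omega⟩
      have := Nat.geomSum_eq (m := q + 1) (by omega) ((N.factorization (q + 1)) + 1)
      have h5 := geom_sum_mul_add q (N.factorization (q + 1) + 1)
      simp only [Nat.add_sub_cancel]
      rw [mul_comm, h5, pow_succ, mul_comm])
    (by
      intro p h
      have h1 : 1 ≤ N.factorization p :=
        (Nat.prime_of_mem_primeFactors h).factorization_pos_of_dvd hpos.ne'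
          (Nat.dvd_of_mem_primeFactors h)
      simp only [Finset.sum_range_succ]
      have : 0 < ∑ k ∈ Finset.range (N.factorization p), p ^ k :=
        Finset.sum_pos (fun i _ => Nat.pow_pos (by have := h3 p h; omega))
          ⟨0, Finset.mem_range.2 h1⟩
      omega)
    (by rw [hs, hprod]) (2 * N.primeFactors.card) ∅ ∅ (by simp) (by simp) (by simp) (by simp)
    (by simp)
  rw [hs, pow_mul] at hcore
  norm_num at hcore
  have : (4 : ℕ) ^ 4 ^ N.primeFactors.card ≤ 4 ^ 4 ^ (N.primeFactors.card + 1) :=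
    Nat.pow_le_pow_right (by norm_num) (Nat.pow_le_pow_right (by norm_num) (by omega))
  omega
end

section
/- For every K > 0 there is an effectively computable bound B(K) such that: if N is an odd perfect number and q^α || N is a prime power exactly dividing N with σ(N/q^α)/q^α < K, then N < B(K). -/
open ArithmeticFunction in
lemma opn_ratio_eq (n : ℕ) (hn : n ≠ 0) : ((sigma 1 n : ℕ) : ℝ) / n =
    ∏ p ∈ n.primeFactors, ((p : ℝ) / (p - 1)) * (1 - (1 / (p : ℝ)) ^ (n.factorization p + 1)) := by
  rw [isMultiplicative_sigma.multiplicative_factorization _ hn]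
  have hn' : (n : ℝ) = ∏ p ∈ n.primeFactors, (p : ℝ) ^ n.factorization p := by
    conv_lhs => rw [← Nat.prod_factorization_pow_eq_self hn]
    rw [Finsupp.prod, Nat.support_factorization]
    push_cast
    rfl
  rw [hn', Finsupp.prod, Nat.support_factorization]
  push_cast
  rw [← Finset.prod_div_distrib]
  apply Finset.prod_congr rfl
  intro p hp
  have pp := Nat.prime_of_mem_primeFactors hp
  have h1 : (1 : ℝ) < p := by exact_mod_cast pp.one_lt
  rw [sigma_one_apply_prime_pow pp]
  push_cast
  rw [geom_sum_eq h1.ne']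
  have : (p : ℝ) - 1 ≠ 0 := by linarith
  have : (p : ℝ) ≠ 0 := by linarith
  rw [one_div, inv_pow]
  field_simp
  ring

lemma opn_one_lt (p : ℕ) (pp : p.Prime) : (1 : ℝ) < p / (p - 1) := by
  have h1 : (1 : ℝ) < p := by exact_mod_cast pp.one_lt
  rw [lt_div_iff₀ (by linarith)]
  linarith

lemma opn_ratio_le (n : ℕ) (hn : n ≠ 0) : ((ArithmeticFunction.sigma 1 n : ℕ) : ℝ) / n ≤
    ∏ p ∈ n.primeFactors, ((p : ℝ) / (p - 1)) := by
  rw [opn_ratio_eq n hn]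
  have key : ∀ p ∈ n.primeFactors, 0 < (1 / (p : ℝ)) ^ (n.factorization p + 1) ∧
      (1 / (p : ℝ)) ^ (n.factorization p + 1) ≤ 1 := by
    intro p hp
    have h1 : (1 : ℝ) < p := by exact_mod_cast (Nat.prime_of_mem_primeFactors hp).one_lt
    refine ⟨by positivity, pow_le_one₀ (by positivity) ?_⟩
    rw [div_le_one (by linarith)]; linarith
  apply Finset.prod_le_prod
  · intro p hp
    have := opn_one_lt p (Nat.prime_of_mem_primeFactors hp)
    have := key p hp
    apply mul_nonneg <;> linarith
  · intro p hp
    have h := opn_one_lt p (Nat.prime_of_mem_primeFactors hp)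
    have := key p hp
    apply mul_le_of_le_one_right <;> linarith

lemma opn_ratio_ge (n L : ℕ) (hn : n ≠ 0) (hL : ∀ p ∈ n.primeFactors, L ≤ n.factorization p) :
    (∏ p ∈ n.primeFactors, ((p : ℝ) / (p - 1))) * (1 - (1 / 2) ^ L) ^ n.primeFactors.card ≤
    ((ArithmeticFunction.sigma 1 n : ℕ) : ℝ) / n := by
  rw [opn_ratio_eq n hn, Finset.prod_mul_distrib, ← Finset.prod_const]
  have h0 : (0 : ℝ) ≤ 1 - (1 / 2) ^ L := by
    have : ((1 : ℝ) / 2) ^ L ≤ 1 := pow_le_one₀ (by norm_num) (by norm_num)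
    linarith
  apply mul_le_mul_of_nonneg_left
  · apply Finset.prod_le_prod
    · intro p hp; exact h0
    · intro p hp
      have h1 : (2 : ℝ) ≤ p := by exact_mod_cast (Nat.prime_of_mem_primeFactors hp).two_le
      have h2 : (1 / (p : ℝ)) ^ (n.factorization p + 1) ≤ (1 / 2) ^ (n.factorization p + 1) := by
        apply pow_le_pow_left₀ (by positivity)
        exact one_div_le_one_div_of_le (by norm_num) h1
      have h3 : ((1 : ℝ) / 2) ^ (n.factorization p + 1) ≤ (1 / 2) ^ L :=
        pow_le_pow_of_le_one (by norm_num) (by norm_num) (by have := hL p hp; omega)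
      linarith
  · apply Finset.prod_nonneg
    intro p hp
    have := opn_one_lt p (Nat.prime_of_mem_primeFactors hp)
    linarith

/-- The limiting abundancy is never `2` when some exponent is infinite. -/
lemma opn_h_ne (M : ℕ) (P : Finset ℕ) (hM : Odd M)
    (hP : ∀ p ∈ P, p.Prime ∧ Odd p ∧ ¬ p ∣ M) (hne : P.Nonempty) :
    ((ArithmeticFunction.sigma 1 M : ℕ) : ℝ) / M * ∏ p ∈ P, ((p : ℝ) / (p - 1)) ≠ 2 := by
  intro h
  have hM0 : (M : ℝ) ≠ 0 := by
    have := hM.pos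
    positivity
  have hcast : ∀ p ∈ P, (p : ℝ) - 1 = ((p - 1 : ℕ) : ℝ) := by
    intro p hp
    have := (hP p hp).1.one_lt
    push_cast [Nat.cast_sub this.le]; ring
  have hne0 : ∏ p ∈ P, ((p : ℝ) - 1) ≠ 0 := by
    rw [Finset.prod_ne_zero_iff]
    intro p hp
    have : (1 : ℝ) < p := by exact_mod_cast (hP p hp).1.one_lt
    linarith
  rw [Finset.prod_div_distrib] at h
  field_simp at h
  rw [Finset.prod_congr rfl hcast] at h
  have h' : ArithmeticFunction.sigma 1 M * ∏ p ∈ P, p = M * 2 * ∏ p ∈ P, (p - 1) := by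
    apply Nat.cast_injective (R := ℝ)
    push_cast
    first
      | linarith [h]
  obtain ⟨pp, ho, hd⟩ := hP _ (P.max'_mem hne)
  have hdvd : P.max' hne ∣ M * 2 * ∏ p ∈ P, (p - 1) := by
    rw [← h']
    exact Dvd.dvd.mul_left (Finset.dvd_prod_of_mem _ (P.max'_mem hne)) _
  rcases (pp.dvd_mul).1 hdvd with h1 | h1
  · rcases (pp.dvd_mul).1 h1 with h2 | h2
    · exact hd h2
    · have := (Nat.prime_dvd_prime_iff_eq pp Nat.prime_two).1 h2
      rw [this] at ho
      exact absurd ho (by decide)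
  · rw [pp.prime.dvd_finsetProd_iff] at h1
    obtain ⟨p, hp, hpd⟩ := h1
    have h3 := P.le_max' p hp
    have h4 := (hP p hp).1.two_le
    have := Nat.le_of_dvd (by omega) hpd
    omega

lemma opn_perfect_sigma {n : ℕ} (h : n.Perfect) : ArithmeticFunction.sigma 1 n = 2 * n := by
  rw [ArithmeticFunction.sigma_one_apply]
  exact (Nat.perfect_iff_sum_divisors_eq_two_mul h.2).1 h

lemma opn_sigma_gt {n : ℕ} (h : 1 < n) : n < ArithmeticFunction.sigma 1 n := by
  rw [ArithmeticFunction.sigma_one_apply, Nat.sum_divisors_eq_sum_properDivisors_add_self]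
  have : 0 < ∑ i ∈ n.properDivisors, i :=
    Finset.sum_pos' (by simp) ⟨1, by simp [h], by norm_num⟩
  omega

lemma opn_step (s M : ℕ) (P : Finset ℕ) (hM : Odd M)
    (hP : ∀ p ∈ P, p.Prime ∧ Odd p ∧ ¬ p ∣ M) :
    ∃ L Y : ℕ, ∀ A R : ℕ, (M * A * R).Perfect → M.Coprime A → (M * A).Coprime R →
      A.primeFactors = P → (∀ p ∈ P, L ≤ A.factorization p) → R.primeFactors.card ≤ s →
      M * A * R = M ∨ ∃ p ∈ R.primeFactors, p < Y := by
  set h : ℝ := ((ArithmeticFunction.sigma 1 M : ℕ) : ℝ) / M * ∏ p ∈ P, ((p : ℝ) / (p - 1)) with hh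
  have hMpos : (0 : ℝ) < M := by exact_mod_cast hM.pos
  have hsM : (0 : ℝ) < ((ArithmeticFunction.sigma 1 M : ℕ) : ℝ) := by
    exact_mod_cast ArithmeticFunction.sigma_pos 1 M hM.pos.ne'
  have hPpos : 0 < ∏ p ∈ P, ((p : ℝ) / (p - 1)) :=
    Finset.prod_pos fun p hp => by linarith [opn_one_lt p (hP p hp).1]
  have hpos : 0 < h := by positivity
  have hmul : ∀ A R : ℕ, (M * A * R).Perfect → M.Coprime A → (M * A).Coprime R →
      A ≠ 0 ∧ R ≠ 0 ∧ (((ArithmeticFunction.sigma 1 M : ℕ) : ℝ) / M) *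
        (((ArithmeticFunction.sigma 1 A : ℕ) : ℝ) / A) *
        (((ArithmeticFunction.sigma 1 R : ℕ) : ℝ) / R) = 2 := by
    intro A R hp h1 h2
    have h3 := opn_perfect_sigma hp
    have h0 := hp.2
    rw [ArithmeticFunction.isMultiplicative_sigma.map_mul_of_coprime h2,
      ArithmeticFunction.isMultiplicative_sigma.map_mul_of_coprime h1] at h3
    have hA : A ≠ 0 := by rintro rfl; simp at h0
    have hR : R ≠ 0 := by rintro rfl; simp at h0
    refine ⟨hA, hR, ?_⟩
    have h4 : ((ArithmeticFunction.sigma 1 M : ℕ) : ℝ) * ((ArithmeticFunction.sigma 1 A : ℕ) : ℝ) *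
      ((ArithmeticFunction.sigma 1 R : ℕ) : ℝ) = 2 * (M * A * R) := by exact_mod_cast h3
    have hA' : (A : ℝ) ≠ 0 := by exact_mod_cast hA
    have hR' : (R : ℝ) ≠ 0 := by exact_mod_cast hR
    field_simp
    linarith
  have hRge : ∀ R : ℕ, R ≠ 0 → (1 : ℝ) ≤ ((ArithmeticFunction.sigma 1 R : ℕ) : ℝ) / R := by
    intro R hR
    have : (0 : ℝ) < R := by positivity
    rw [le_div_iff₀ this, one_mul]
    rcases Nat.lt_or_ge 1 R with h1 | h1
    · exact_mod_cast (opn_sigma_gt h1).le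
    · have : R = 1 := by omega
      subst this; simp
  rcases lt_trichotomy h 2 with hlt | heq | hgt
  · -- h < 2
    have ht : Filter.Tendsto (fun Y : ℕ => h * (1 + 1 / ((Y : ℝ) + 1)) ^ s) Filter.atTop
        (nhds (h * (1 + 0) ^ s)) :=
      ((tendsto_one_div_add_atTop_nhds_zero_nat.const_add 1).pow s).const_mul h
    obtain ⟨Y, hY⟩ := (ht.eventually_lt_const (u := 2) (by simpa using hlt)).exists
    refine ⟨0, Y + 2, fun A R hp h1 h2 hAP _ hs => Or.inr ?_⟩
    obtain ⟨hA, hR, h3⟩ := hmul A R hp h1 h2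
    by_contra! hc
    have h4 := opn_ratio_le A hA
    have h5 := opn_ratio_le R hR
    rw [hAP] at h4
    have h6 : ∏ p ∈ R.primeFactors, ((p : ℝ) / (p - 1)) ≤ (1 + 1 / ((Y : ℝ) + 1)) ^ s := by
      calc _ ≤ ∏ p ∈ R.primeFactors, (1 + 1 / ((Y : ℝ) + 1)) := by
            apply Finset.prod_le_prod
            · intro p hp
              linarith [opn_one_lt p (Nat.prime_of_mem_primeFactors hp)]
            · intro p hp
              have h7 : ((Y : ℝ) + 2) ≤ p := by exact_mod_cast hc p hp
              have hY0 : (0 : ℝ) ≤ Y := by positivity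
              have h8 : (p : ℝ) / (p - 1) = 1 + 1 / (p - 1) := by
                have : (p : ℝ) - 1 ≠ 0 := by linarith
                field_simp; ring
              rw [h8]
              have := one_div_le_one_div_of_le (by linarith : (0 : ℝ) < Y + 1)
                (by linarith : (Y : ℝ) + 1 ≤ p - 1)
              linarith
        _ = (1 + 1 / ((Y : ℝ) + 1)) ^ R.primeFactors.card := Finset.prod_const _
        _ ≤ _ := pow_le_pow_right₀ (by
          have : (0 : ℝ) ≤ 1 / ((Y : ℝ) + 1) := by positivity
          linarith) hs
    have : (2 : ℝ) ≤ h * (1 + 1 / ((Y : ℝ) + 1)) ^ s := by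
      rw [← h3, hh]
      have := hRge R hR
      gcongr
      linarith
    linarith
  · -- h = 2
    refine ⟨0, 0, fun A R hp h1 h2 hAP _ hs => Or.inl ?_⟩
    obtain ⟨hA, hR, h3⟩ := hmul A R hp h1 h2
    rcases P.eq_empty_or_nonempty with hPe | hPe
    · subst hPe
      rw [Nat.primeFactors_eq_empty] at hAP
      have hA1 : A = 1 := by omega
      subst hA1
      simp at hh h3
      rw [← hh, heq] at h3
      have h4 : ((ArithmeticFunction.sigma 1 R : ℕ) : ℝ) / R = 1 := by linarith
      rw [div_eq_one_iff_eq (by exact_mod_cast hR)] at h4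
      have h5 : ArithmeticFunction.sigma 1 R = R := by exact_mod_cast h4
      have : ¬ 1 < R := fun h => by have := opn_sigma_gt h; omega
      have : R = 1 := by omega
      simp [this]
    · exact absurd heq (opn_h_ne M P hM hP hPe)
  · -- 2 < h
    have ht : Filter.Tendsto (fun L : ℕ => h * (1 - (1 / 2 : ℝ) ^ L) ^ P.card) Filter.atTop
        (nhds (h * (1 - 0) ^ P.card)) :=
      (((tendsto_pow_atTop_nhds_zero_of_lt_one (by norm_num) (by norm_num)).const_sub 1).pow
        P.card).const_mul h
    obtain ⟨L, hL⟩ := (ht.eventually_const_lt (u := 2) (by simpa using hgt)).exists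
    refine ⟨L, 0, fun A R hp h1 h2 hAP hAL hs => ?_⟩
    exfalso
    obtain ⟨hA, hR, h3⟩ := hmul A R hp h1 h2
    have h4 := opn_ratio_ge A L hA (by rwa [hAP])
    rw [hAP] at h4
    have h5 := hRge R hR
    have h6 : h * (1 - (1 / 2 : ℝ) ^ L) ^ P.card ≤ (((ArithmeticFunction.sigma 1 M : ℕ) : ℝ) / M) *
        (((ArithmeticFunction.sigma 1 A : ℕ) : ℝ) / A) := by
      rw [hh, mul_assoc]
      gcongr
    nlinarith

theorem opn_dickson_aux (s : ℕ) : ∀ (M : ℕ) (P : Finset ℕ), Odd M →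
    (∀ p ∈ P, p.Prime ∧ Odd p ∧ ¬ p ∣ M) →
    ∃ L B : ℕ, ∀ A R : ℕ, (M * A * R).Perfect → Odd (M * A * R) → M.Coprime A →
      (M * A).Coprime R → A.primeFactors = P → (∀ p ∈ P, L ≤ A.factorization p) →
      R.primeFactors.card ≤ s → M * A * R ≤ B := by
  induction s with
  | zero =>
    intro M P hM hP
    obtain ⟨L, Y, h⟩ := opn_step 0 M P hM hP
    refine ⟨L, M, fun A R hp ho h1 h2 h3 h4 h5 => ?_⟩
    rcases h A R hp h1 h2 h3 h4 h5 with h | ⟨p, hp, -⟩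
    · exact h.le
    · rw [Nat.le_zero, Finset.card_eq_zero] at h5
      rw [h5] at hp
      simp at hp
  | succ s ih =>
    intro M P hM hP
    obtain ⟨L₀, Y, hY⟩ := opn_step (s + 1) M P hM hP
    have key : ∀ r : ℕ, ∃ L B : ℕ, ∀ A R : ℕ, (M * A * R).Perfect → Odd (M * A * R) →
        M.Coprime A → (M * A).Coprime R → A.primeFactors = P →
        (∀ p ∈ P, L ≤ A.factorization p) → R.primeFactors.card ≤ s + 1 →
        r ∈ R.primeFactors → M * A * R ≤ B := by
      intro r
      by_cases hr : r.Prime ∧ Odd r ∧ ¬ r ∣ M ∧ r ∉ P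
      swap
      · refine ⟨0, 0, fun A R hp ho h1 h2 h3 h4 h5 h6 => ?_⟩
        exfalso
        apply hr
        have rp := Nat.prime_of_mem_primeFactors h6
        have rd := Nat.dvd_of_mem_primeFactors h6
        have hMA : ¬ r ∣ M * A := fun h => Nat.not_coprime_of_dvd_of_dvd rp.one_lt h rd h2
        refine ⟨rp, ho.of_dvd_nat (rd.mul_left _), fun h => hMA (h.mul_right _), fun h => ?_⟩
        rw [← h3] at h
        exact hMA ((Nat.dvd_of_mem_primeFactors h).mul_left _)
      obtain ⟨rp, ro, rM, rP⟩ := hr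
      obtain ⟨L₁, B₁, h₁⟩ := ih M (insert r P) hM (by
        intro p hp
        rcases Finset.mem_insert.1 hp with rfl | hp
        · exact ⟨rp, ro, rM⟩
        · exact hP p hp)
      have h₂ : ∀ e : ℕ, _ := fun e => ih (M * r ^ e) P (hM.mul (ro.pow)) (by
        intro p hp
        obtain ⟨pp, po, pM⟩ := hP p hp
        refine ⟨pp, po, fun h => ?_⟩
        rcases pp.dvd_mul.1 h with h | h
        · exact pM h
        · have := (Nat.prime_dvd_prime_iff_eq pp rp).1 (pp.dvd_of_dvd_pow h)
          exact rP (this ▸ hp))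
      choose L₂ B₂ h₂ using h₂
      refine ⟨L₁ + ∑ e ∈ Finset.range L₁, L₂ e, B₁ + ∑ e ∈ Finset.range L₁, B₂ e,
        fun A R hp ho h1 h2 h3 h4 h5 h6 => ?_⟩
      have hR0 : R ≠ 0 := by rintro rfl; simp at h6
      have rd := Nat.dvd_of_mem_primeFactors h6
      have hMA : ¬ r ∣ M * A := fun h => Nat.not_coprime_of_dvd_of_dvd rp.one_lt h rd h2
      have hMA0 : M * A ≠ 0 := by rintro h; rw [h] at hMA; simp at hMA
      have hA0 : A ≠ 0 := right_ne_zero_of_mul hMA0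
      obtain ⟨e, R', hR', hRe⟩ := Nat.exists_eq_pow_mul_and_not_dvd hR0 r rp.ne_one
      have he : e ≠ 0 := by
        rintro rfl
        simp at hRe
        exact hR' (hRe ▸ rd)
      have crR : (r ^ e).Coprime R' := Nat.Coprime.pow_left _ ((rp.coprime_iff_not_dvd).2 hR')
      have crMA : (M * A).Coprime (r ^ e) :=
        (Nat.Coprime.pow_left _ ((rp.coprime_iff_not_dvd).2 hMA)).symm
      have cR' : (M * A).Coprime R' := h2.coprime_dvd_right (hRe ▸ Dvd.intro_left _ rfl)
      have hcard : R'.primeFactors.card ≤ s := by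
        have h7 : R.primeFactors = insert r R'.primeFactors := by
          rw [hRe, Nat.Coprime.primeFactors_mul crR, Nat.primeFactors_prime_pow he rp,
            Finset.insert_eq]
        rw [h7, Finset.card_insert_of_notMem (fun h => hR' (Nat.dvd_of_mem_primeFactors h))] at h5
        omega
      by_cases hle : L₁ ≤ e
      · have heq : M * (A * r ^ e) * R' = M * A * R := by rw [hRe]; ring
        have := h₁ (A * r ^ e) R' (heq ▸ hp) (heq ▸ ho)
          (h1.mul_right (crMA.coprime_dvd_left (Dvd.intro _ rfl)))
          (by rw [← mul_assoc]; exact Nat.Coprime.mul_left cR' crR)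
          (by
            rw [Nat.Coprime.primeFactors_mul (crMA.coprime_dvd_left (Dvd.intro_left _ rfl)), h3,
              Nat.primeFactors_prime_pow he rp, Finset.insert_eq, Finset.union_comm])
          (by
            intro p hp
            rw [Nat.factorization_mul hA0 (pow_ne_zero _ rp.ne_zero), Finsupp.add_apply]
            rcases Finset.mem_insert.1 hp with rfl | hp
            · rw [rp.factorization_pow]; simp; omega
            · have := h4 p hp
              omega)
          hcard
        rw [heq] at this
        omega
      · have heq : M * r ^ e * A * R' = M * A * R := by rw [hRe]; ring
        have hL := Finset.single_le_sum (f := L₂) (fun i _ => Nat.zero_le _)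
          (Finset.mem_range.2 (not_le.1 hle))
        have hB := Finset.single_le_sum (f := B₂) (fun i _ => Nat.zero_le _)
          (Finset.mem_range.2 (not_le.1 hle))
        have := h₂ e A R' (heq ▸ hp) (heq ▸ ho)
          (Nat.Coprime.mul_left h1 (crMA.coprime_dvd_left (Dvd.intro_left _ rfl)).symm)
          (by
            rw [mul_right_comm]
            exact Nat.Coprime.mul_left cR' crR)
          h3 (fun p hp => by have := h4 p hp; omega) hcard
        rw [heq] at this
        omega
    choose L B hLB using key
    refine ⟨L₀ + ∑ r ∈ Finset.range Y, L r, M + ∑ r ∈ Finset.range Y, B r,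
      fun A R hp ho h1 h2 h3 h4 h5 => ?_⟩
    rcases hY A R hp h1 h2 h3 (fun p hp => by have := h4 p hp; omega) h5 with h | ⟨r, hr, hrY⟩
    · omega
    · have hL := Finset.single_le_sum (f := L) (fun i _ => Nat.zero_le _) (Finset.mem_range.2 hrY)
      have hB := Finset.single_le_sum (f := B) (fun i _ => Nat.zero_le _) (Finset.mem_range.2 hrY)
      have := hLB r A R hp ho h1 h2 h3 (fun p hp => by have := h4 p hp; omega) h5 hr
      omega

/-- Dickson: finitely many odd perfect numbers with at most `s` distinct prime factors. -/
theorem opn_dickson (s : ℕ) : ∃ B : ℕ, ∀ N : ℕ, N.Perfect → Odd N →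
    N.primeFactors.card ≤ s → N ≤ B := by
  obtain ⟨L, B, h⟩ := opn_dickson_aux s 1 ∅ odd_one (by simp)
  refine ⟨B, fun N hp ho hs => ?_⟩
  simpa using h 1 N (by simpa using hp) (by simpa using ho) (by simp) (by simp) (by simp)
    (by simp) hs

/-- Special case of Bang's theorem. -/
lemma opn_bang (q a b : ℕ) (hq : 3 ≤ q) (ha : a.Prime) (hb : b.Prime) (ha2 : 3 ≤ a) (hb2 : 3 ≤ b)
    (hab : a ≠ b) : ∃ l : ℕ, l.Prime ∧ orderOf (q : ZMod l) = a * b := by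
  by_contra! hcon
  set d := a * b with hd
  have hdpos : 9 ≤ d := by nlinarith
  set F : ℤ := (Polynomial.cyclotomic d ℤ).eval (q : ℤ) with hF
  have hcop : a.Coprime b := (Nat.coprime_primes ha hb).2 hab
  -- lower bound
  have hlow : (d : ℤ) < F := by
    have h1 := Polynomial.sub_one_pow_totient_lt_cyclotomic_eval (n := d) (q := (q : ℝ)) (by omega)
      (by exact_mod_cast (by omega : 1 < q))
    have h2 : Polynomial.eval (q : ℝ) (Polynomial.cyclotomic d ℝ) = (F : ℝ) := by
      rw [hF, ← Polynomial.map_cyclotomic_int d ℝ, Polynomial.eval_natCast_map]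
      simp
    have h3 : d ≤ 2 ^ d.totient := by
      rw [hd, Nat.totient_mul hcop, Nat.totient_prime ha, Nat.totient_prime hb]
      have e1 : a ≤ 2 ^ (a - 1) := by have := Nat.lt_two_pow_self (n := a - 1); omega
      have e2 : b ≤ 2 ^ (b - 1) := by have := Nat.lt_two_pow_self (n := b - 1); omega
      calc a * b ≤ 2 ^ (a - 1) * 2 ^ (b - 1) := Nat.mul_le_mul e1 e2
        _ = 2 ^ ((a - 1) + (b - 1)) := by rw [pow_add]
        _ ≤ _ := by
          apply Nat.pow_le_pow_right (by norm_num)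
          obtain ⟨x, rfl⟩ : ∃ x, a = x + 3 := ⟨a - 3, by omega⟩
          obtain ⟨y, rfl⟩ : ∃ y, b = y + 3 := ⟨b - 3, by omega⟩
          simp only [Nat.add_succ_sub_one]
          nlinarith
    rw [h2] at h1
    have h4 : (d : ℝ) ≤ (2 : ℝ) ^ d.totient := by exact_mod_cast h3
    have h5 : (2 : ℝ) ^ d.totient ≤ ((q : ℝ) - 1) ^ d.totient := by
      apply pow_le_pow_left₀ (by norm_num)
      have : (3 : ℝ) ≤ q := by exact_mod_cast hq
      linarith
    have : (d : ℝ) < (F : ℝ) := by linarith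
    exact_mod_cast this
  obtain ⟨f, hf⟩ : ∃ f : ℕ, F = f := ⟨F.toNat, by omega⟩
  have hfd : d < f := by rw [hf] at hlow; exact_mod_cast hlow
  have hdvd : ∀ m ∈ d.properDivisors, (q ^ m - 1) * f ∣ q ^ d - 1 := by
    intro m hm
    have h1 := Polynomial.X_pow_sub_one_mul_cyclotomic_dvd_X_pow_sub_one_of_dvd ℤ hm
    have h2 := map_dvd (Polynomial.evalRingHom (q : ℤ)) h1
    simp only [Polynomial.coe_evalRingHom, Polynomial.eval_mul, Polynomial.eval_sub,
      Polynomial.eval_pow, Polynomial.eval_X, Polynomial.eval_one] at h2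
    rw [← hF, hf] at h2
    have h3 : ∀ n : ℕ, (q : ℤ) ^ n - 1 = ((q ^ n - 1 : ℕ) : ℤ) := by
      intro n
      have : 1 ≤ q ^ n := Nat.one_le_pow _ _ (by omega)
      push_cast [Nat.cast_sub this]; ring
    rw [h3, h3] at h2
    exact_mod_cast h2
  -- each prime divisor divides d
  have hpr : ∀ l : ℕ, l.Prime → l ∣ f → l ∣ d := by
    intro l hl hlf
    by_contra hld
    have := Fact.mk hl
    have : NeZero ((d : ℕ) : ZMod l) := ⟨by
      rw [Ne, ZMod.natCast_eq_zero_iff]; exact hld⟩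
    apply hcon l hl
    have h1 : (Polynomial.cyclotomic d (ZMod l)).IsRoot (q : ZMod l) := by
      rw [Polynomial.IsRoot, ← Polynomial.map_cyclotomic_int d (ZMod l)]
      have h2 : Polynomial.eval (q : ZMod l) (Polynomial.map (Int.castRingHom (ZMod l))
          (Polynomial.cyclotomic d ℤ)) = ((F : ℤ) : ZMod l) := by
        rw [hF, Polynomial.eval_natCast_map]
        simp
      rw [h2, hf]
      simpa [ZMod.natCast_eq_zero_iff] using hlf
    exact (Polynomial.isRoot_cyclotomic_iff.1 h1).eq_orderOf.symm
  -- valuation bound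
  have hval : ∀ l m : ℕ, l.Prime → 3 ≤ l → 1 < m → d = m * l → ¬ l ^ 2 ∣ f := by
    intro l m hl hl3 hm hdm hl2
    have := Fact.mk hl
    have hlo : Odd l := hl.odd_of_ne_two (by omega)
    have hmp : m ∈ d.properDivisors := by
      rw [Nat.mem_properDivisors]
      refine ⟨Dvd.intro _ hdm.symm, ?_⟩
      rw [hdm]; nlinarith
    have h1 := hdvd m hmp
    have hqm : 1 < q ^ m := Nat.one_lt_pow (by omega) (by omega)
    have hqd : 1 < q ^ d := Nat.one_lt_pow (by omega) (by omega)
    have hld : l ∣ q ^ d - 1 :=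
      ((dvd_pow_self l two_ne_zero).trans hl2).trans ((Dvd.intro_left _ rfl).trans h1)
    have hlq : ¬ l ∣ q := by
      intro h
      have h2 : l ∣ q ^ d := h.trans (dvd_pow_self _ (by omega))
      have := (Nat.dvd_sub_iff_right hqd.le h2).1 hld
      exact hl.one_lt.ne' (Nat.dvd_one.1 this)
    have hlm : l ∣ q ^ m - 1 := by
      rw [← Nat.modEq_iff_dvd' hqm.le, ← ZMod.natCast_eq_natCast_iff]
      have h2 : ((1 : ℕ) : ZMod l) = ((q ^ d : ℕ) : ZMod l) := by
        rw [ZMod.natCast_eq_natCast_iff, Nat.modEq_iff_dvd' hqd.le]; exact hld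
      rw [h2, hdm, pow_mul]
      push_cast
      rw [ZMod.pow_card]
    have h3 := padicValNat.pow_sub_pow (p := l) (x := q ^ m) (y := 1) hlo hqm hlm
      (fun h => hlq (hl.dvd_of_dvd_pow h)) (n := l) hl.ne_zero
    rw [one_pow, ← pow_mul, ← hdm, padicValNat.self hl.one_lt] at h3
    have h4 : (q ^ m - 1) * l ^ 2 ∣ q ^ d - 1 := (Nat.mul_dvd_mul_left _ hl2).trans h1
    obtain ⟨c, hc⟩ := h4
    have hc0 : c ≠ 0 := by rintro rfl; simp at hc; omega
    have hl20 : l ^ 2 ≠ 0 := pow_ne_zero _ hl.ne_zero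
    have hm0 : q ^ m - 1 ≠ 0 := by omega
    rw [hc, padicValNat.mul (mul_ne_zero hm0 hl20) hc0, padicValNat.mul hm0 hl20,
      padicValNat.prime_pow] at h3
    omega
  have hva := hval a b ha ha2 hb.one_lt (by rw [hd, mul_comm])
  have hvb := hval b a hb hb2 ha.one_lt hd
  have : f ∣ d := by
    rw [← Nat.factorization_le_iff_dvd (by omega) (by omega)]
    intro l
    by_cases hl : l.Prime ∧ l ∣ f
    · obtain ⟨hl, hlf⟩ := hl
      have h1 : ¬ l ^ 2 ∣ f := by
        rcases hl.dvd_mul.1 (hpr l hl hlf) with h | h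
        · rw [(Nat.prime_dvd_prime_iff_eq hl ha).1 h]; exact hva
        · rw [(Nat.prime_dvd_prime_iff_eq hl hb).1 h]; exact hvb
      rw [hl.pow_dvd_iff_le_factorization (by omega)] at h1
      have h2 := (hl.dvd_iff_one_le_factorization (by omega)).1 (hpr l hl hlf)
      omega
    · rw [not_and_or] at hl
      have : f.factorization l = 0 := by
        rw [Nat.factorization_eq_zero_iff]; tauto
      omega
  have := Nat.le_of_dvd (by omega) this
  omega

/-- If `1 + p + ... + p^a = q^b` with `a ≥ 2`, and `p^2 ∣ q^n - 1`, then `p ∣ n`. -/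
lemma opn_dvd_exponent (p q a b n : ℕ) (hp : p.Prime) (ha : 1 ≤ a) 
    (h : ∑ k ∈ Finset.range (a + 1), p ^ k = q ^ b) (hn : (q : ZMod (p ^ 2)) ^ n = 1) : p ∣ n := by
  by_contra hpn
  obtain ⟨a, rfl⟩ : ∃ a', a = a' + 1 := ⟨a - 1, by omega⟩
  have h0 : (p : ZMod (p ^ 2)) ^ 2 = 0 := by
    have := ZMod.natCast_self (p ^ 2)
    push_cast at this; exact this
  have hx : ((q : ZMod (p ^ 2)) ^ b) = 1 + p := by
    have h1 := congrArg (Nat.cast (R := ZMod (p ^ 2))) h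
    rw [Finset.sum_range_succ', Finset.sum_range_succ'] at h1
    push_cast at h1
    rw [← h1, Finset.sum_eq_zero]
    · ring
    · intro k _
      rw [add_assoc, pow_add, show 1 + 1 = 2 from rfl, h0, mul_zero]
  have h2 : ∀ n : ℕ, (1 + (p : ZMod (p ^ 2))) ^ n = 1 + n * p := by
    intro n
    induction n with
    | zero => simp
    | succ n ih =>
      rw [pow_succ (1 + (p : ZMod (p ^ 2))) n, ih]
      push_cast
      linear_combination (n : ZMod (p ^ 2)) * h0
  have h3 : (((n * p : ℕ)) : ZMod (p ^ 2)) = 0 := by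
    have h4 := h2 n
    rw [← hx, ← pow_mul, mul_comm b n, pow_mul, hn, one_pow] at h4
    push_cast
    linear_combination -h4
  rw [ZMod.natCast_eq_zero_iff, pow_two] at h3
  exact hpn (Nat.dvd_of_mul_dvd_mul_right hp.pos h3)

lemma opn_card_bound (t K : ℕ) (h : t.choose 2 ≤ 1 + (t + 2 * K)) : t ≤ 2 * K + 5 := by
  by_contra! hc
  rw [Nat.choose_two_right] at h
  obtain ⟨u, rfl⟩ : ∃ u, t = u + 1 := ⟨t - 1, by omega⟩
  simp only [Nat.add_sub_cancel] at h
  have h1 : (u + 1) * u ≤ 2 * (1 + (u + 1 + 2 * K)) + 1 := by omega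
  nlinarith

lemma opn_omega_bound (K N q α : ℕ) (hN : N.Perfect) (hodd : Odd N) (hq : q.Prime) (hα : 1 ≤ α)
    (hd : q ^ α ∣ N) (hnd : ¬ q ^ (α + 1) ∣ N)
    (hlt : (ArithmeticFunction.sigma 1 (N / q ^ α)) / q ^ α < K) :
    N.primeFactors.card ≤ 4 * K + 10 := by
  obtain ⟨m, rfl⟩ := hd
  have hqa : 0 < q ^ α := pow_pos hq.pos _
  rw [Nat.mul_div_cancel_left _ hqa] at hlt
  rw [Nat.div_lt_iff_lt_mul hqa] at hlt
  have hqm : ¬ q ∣ m := fun h => hnd (by rw [pow_succ]; exact Nat.mul_dvd_mul_left _ h)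
  have hcop : (q ^ α).Coprime m := Nat.Coprime.pow_left _ (hq.coprime_iff_not_dvd.2 hqm)
  have hm0 : m ≠ 0 := by rintro rfl; simp at hqm
  have hqodd : Odd q := hodd.of_dvd_nat ((dvd_pow_self q (by omega)).mul_right m)
  have hq3 : 3 ≤ q := by
    have := hq.two_le
    rcases hqodd with ⟨c, hc⟩
    omega
  have hmodd : Odd m := hodd.of_dvd_nat (Dvd.intro_left _ rfl)
  have hs := opn_perfect_sigma hN
  rw [ArithmeticFunction.isMultiplicative_sigma.map_mul_of_coprime hcop,
    ArithmeticFunction.sigma_one_apply_prime_pow hq] at hs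
  set G := ∑ k ∈ Finset.range (α + 1), q ^ k with hG
  have hqG : (q ^ α).Coprime G := by
    apply Nat.Coprime.pow_left
    rw [hq.coprime_iff_not_dvd, hG, Finset.sum_range_succ']
    intro h
    have h1 : q ∣ ∑ k ∈ Finset.range α, q ^ (k + 1) :=
      Finset.dvd_sum fun k _ => dvd_pow_self q (by omega)
    have := (Nat.dvd_add_right h1).1 h
    rw [pow_zero, Nat.dvd_one] at this
    exact hq.ne_one this
  obtain ⟨k, hk⟩ : q ^ α ∣ ArithmeticFunction.sigma 1 m := by
    apply hqG.dvd_of_dvd_mul_left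
    rw [hs]
    exact Dvd.intro (2 * m) (by ring)
  have hkK : k < K := by
    rw [hk, mul_comm K] at hlt
    exact Nat.lt_of_mul_lt_mul_left hlt
  have hk0 : k ≠ 0 := by
    rintro rfl
    have := ArithmeticFunction.sigma_pos 1 m hm0
    omega
  have hGk : G * k = 2 * m := by
    apply Nat.eq_of_mul_eq_mul_left hqa
    rw [hk] at hs
    linarith
  -- decomposition of the sigma values
  have hdec : ∀ p ∈ m.primeFactors, ∃ e c : ℕ, ¬ q ∣ c ∧
      ArithmeticFunction.sigma 1 (p ^ m.factorization p) = q ^ e * c := by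
    intro p hp
    have pp := Nat.prime_of_mem_primeFactors hp
    exact Nat.exists_eq_pow_mul_and_not_dvd
      (ArithmeticFunction.sigma_pos 1 _ (pow_ne_zero _ pp.ne_zero)).ne' q hq.ne_one
  choose! e c hqc hec using hdec
  have hprod : ∏ p ∈ m.primeFactors, c p ∣ k := by
    have h1 : q ^ α * k = q ^ (∑ p ∈ m.primeFactors, e p) * ∏ p ∈ m.primeFactors, c p := by
      rw [← hk, ArithmeticFunction.isMultiplicative_sigma.multiplicative_factorization _ hm0,
        Finsupp.prod, Nat.support_factorization, ← Finset.prod_pow_eq_pow_sum,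
        ← Finset.prod_mul_distrib]
      exact Finset.prod_congr rfl hec
    have h2 : (∏ p ∈ m.primeFactors, c p).Coprime (q ^ α) := by
      apply Nat.Coprime.pow_right
      apply Nat.Coprime.prod_left
      intro p hp
      exact (hq.coprime_iff_not_dvd.2 (hqc p hp)).symm
    exact h2.dvd_of_dvd_mul_left (h1 ▸ Dvd.intro_left _ rfl)
  have hcpos : ∀ p ∈ m.primeFactors, 1 ≤ c p := by
    intro p hp
    by_contra h
    have : c p = 0 := by omega
    exact hqc p hp (this ▸ dvd_zero q)
  set T := m.primeFactors with hT
  set Bad1 := T.filter (fun p => p ∣ k)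
  set Bad2 := T.filter (fun p => c p ≠ 1)
  set Gd := T.filter (fun p => ¬ p ∣ k ∧ c p = 1) with hGd
  have hb1 : Bad1.card ≤ K := by
    calc Bad1.card ≤ (Finset.Icc 1 k).card := by
          apply Finset.card_le_card
          intro p hp
          rw [Finset.mem_filter] at hp
          rw [Finset.mem_Icc]
          exact ⟨(Nat.prime_of_mem_primeFactors hp.1).one_lt.le,
            Nat.le_of_dvd (by omega) hp.2⟩
      _ ≤ K := by simp; omega
  have hb2 : Bad2.card ≤ K := by
    have h1 : 2 ^ Bad2.card ≤ ∏ p ∈ Bad2, c p := by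
      rw [← Finset.prod_const]
      apply Finset.prod_le_prod'
      intro p hp
      rw [Finset.mem_filter] at hp
      have := hcpos p hp.1
      have := hp.2
      omega
    have h2 : ∏ p ∈ Bad2, c p ∣ ∏ p ∈ T, c p :=
      Finset.prod_dvd_prod_of_subset _ _ _ (Finset.filter_subset _ _)
    have h3 := Nat.le_of_dvd (by omega) (h2.trans hprod)
    have := Nat.lt_two_pow_self (n := Bad2.card)
    omega
  have hTcard : T.card ≤ Gd.card + 2 * K := by
    have h1 : T ⊆ Gd ∪ (Bad1 ∪ Bad2) := by
      intro p hp
      simp only [Finset.mem_union, Finset.mem_filter, Gd, Bad1, Bad2]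
      tauto
    have h2 := Finset.card_le_card h1
    have h3 := Finset.card_union_le Gd (Bad1 ∪ Bad2)
    have h4 := Finset.card_union_le Bad1 Bad2
    omega
  -- good primes divide α + 1
  have hgood : ∀ p ∈ Gd, p.Prime ∧ 3 ≤ p ∧ p ∣ α + 1 := by
    intro p hp
    rw [hGd, Finset.mem_filter] at hp
    obtain ⟨hpT, hpk, hpc⟩ := hp
    have pp := Nat.prime_of_mem_primeFactors hpT
    have pd := Nat.dvd_of_mem_primeFactors hpT
    have podd : Odd p := hmodd.of_dvd_nat pd
    have hp3 : 3 ≤ p := by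
      have := pp.two_le
      rcases podd with ⟨c, hc⟩
      omega
    refine ⟨pp, hp3, ?_⟩
    have h1 := hec p hpT
    rw [hpc, mul_one, ArithmeticFunction.sigma_one_apply_prime_pow pp] at h1
    have ha1 : 1 ≤ m.factorization p := (pp.dvd_iff_one_le_factorization hm0).1 pd
    have ha2 : 2 ≤ m.factorization p := by
      by_contra h
      have h2 : m.factorization p = 1 := by omega
      rw [h2] at h1
      simp [Finset.sum_range_succ] at h1
      have h3 : Odd (1 + p) := h1 ▸ hqodd.pow
      rcases h3 with ⟨x, hx⟩
      rcases podd with ⟨y, hy⟩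
      omega
    apply opn_dvd_exponent p q _ _ (α + 1) pp ha1 h1
    have h2 : p ^ 2 ∣ G := by
      have h3 : p ^ 2 ∣ G * k := by
        rw [hGk]
        exact ((pp.pow_dvd_iff_le_factorization hm0).2 ha2).mul_left 2
      exact (Nat.Coprime.pow_left 2 (pp.coprime_iff_not_dvd.2 hpk)).dvd_of_dvd_mul_right h3
    have h3 := geom_sum_mul (q : ZMod (p ^ 2)) (α + 1)
    have h4 : ((G : ℕ) : ZMod (p ^ 2)) = 0 := (ZMod.natCast_eq_zero_iff _ _).2 h2
    rw [hG] at h4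
    push_cast at h4
    rw [h4, zero_mul] at h3
    exact (sub_eq_zero.1 h3.symm)
  -- pairs of good primes give primitive primes
  have hpair : ∀ u ∈ Gd.powersetCard 2, ∃ l : ℕ, l ∈ (2 * m).primeFactors ∧
      orderOf (q : ZMod l) = ∏ x ∈ u, x := by
    intro u hu
    rw [Finset.mem_powersetCard, Finset.card_eq_two] at hu
    obtain ⟨hu, a, b, hab, rfl⟩ := hu
    obtain ⟨ap, a3, ad⟩ := hgood a (hu (by simp))
    obtain ⟨bp, b3, bd⟩ := hgood b (hu (by simp))
    obtain ⟨l, lp, hl⟩ := opn_bang q a b hq3 ap bp a3 b3 hab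
    refine ⟨l, ?_, by rw [hl, Finset.prod_pair hab]⟩
    rw [Nat.mem_primeFactors]
    refine ⟨lp, ?_, by omega⟩
    have := Fact.mk lp
    rw [← hGk]
    apply Dvd.dvd.mul_right
    have h1 : a * b ∣ α + 1 := ((Nat.coprime_primes ap bp).2 hab).mul_dvd_of_dvd_of_dvd ad bd
    have h2 : (q : ZMod l) ^ (α + 1) = 1 := orderOf_dvd_iff_pow_eq_one.1 (hl ▸ h1)
    have h3 := geom_sum_mul (q : ZMod l) (α + 1)
    rw [h2, sub_self] at h3
    rcases mul_eq_zero.1 h3 with h4 | h4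
    · rw [← ZMod.natCast_eq_zero_iff, hG]
      push_cast
      exact h4
    · exfalso
      rw [sub_eq_zero.1 h4, orderOf_one] at hl
      nlinarith
  choose! l hl1 hl2 using hpair
  have hchoose : Gd.card.choose 2 ≤ (2 * m).primeFactors.card := by
    rw [← Finset.card_powersetCard]
    apply Finset.card_le_card_of_injOn l hl1
    intro u hu v hv huv
    have h1 := hl2 u hu
    rw [huv, hl2 v hv] at h1
    rw [Finset.mem_coe, Finset.mem_powersetCard] at hu hv
    rw [← Nat.primeFactors_prod (fun p hp => (hgood p (hu.1 hp)).1),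
      ← Nat.primeFactors_prod (fun p hp => (hgood p (hv.1 hp)).1), h1]
  have h2m : (2 * m).primeFactors.card ≤ 1 + T.card := by
    rw [Nat.primeFactors_mul two_ne_zero hm0]
    refine (Finset.card_union_le _ _).trans ?_
    rw [Nat.Prime.primeFactors Nat.prime_two]
    simp [hT]
  have hN2 : (q ^ α * m).primeFactors.card ≤ 1 + T.card := by
    rw [Nat.primeFactors_mul hqa.ne' hm0]
    refine (Finset.card_union_le _ _).trans ?_
    rw [Nat.primeFactors_prime_pow (by omega) hq]
    simp [hT]
  have := opn_card_bound Gd.card K (by omega)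
  omega

theorem opn_bounded_of_small_ratio (K : ℕ) (hK : 0 < K) :
    ∃ B : ℕ, ∀ N q α : ℕ, N.Perfect → Odd N → q.Prime → 1 ≤ α →
      q ^ α ∣ N → ¬ q ^ (α + 1) ∣ N →
      (ArithmeticFunction.sigma 1 (N / q ^ α)) / q ^ α < K → N < B := by
  obtain ⟨B, hB⟩ := opn_dickson (4 * K + 10)
  refine ⟨B + 1, fun N q α h1 h2 h3 h4 h5 h6 h7 => ?_⟩
  exact Nat.lt_succ_of_le (hB N h1 h2 (opn_omega_bound K N q α h1 h2 h3 h4 h5 h6 h7))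
end
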